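/- arXiv:1609.01940 — 5 statements merged into one kernel-verified Lean document; each statement's English description precedes it below -/
import Mathlib

section
/- Let f : ℝ → ℝ be n times differentiable, let x_1 < x_2 < … < x_n be pairwise distinct real points, and let y be a real number strictly greater than each x_i. Let π be the unique polynomial of degree at most n−1 interpolating f at x_1, …, x_n, and let ω(x) = (x − x_1)···(x − x_n). Then there exists ξ ∈ [x_1, y] such that f(y) − π(y) = ω(y) · f^{(n)}(ξ) / n!. -/
theorem exists_iteratedDeriv_eq_zero (n : ℕ) (g : ℝ → ℝ)
    (hg : ∀ k < n, Differentiable ℝ (iteratedDeriv k g))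
    (z : Fin (n + 1) → ℝ) (hz : StrictMono z) (hzero : ∀ i, g (z i) = 0) :
    ∃ ξ ∈ Set.Icc (z 0) (z (Fin.last n)), iteratedDeriv n g ξ = 0 := by
  induction n generalizing g with
  | zero => exact ⟨z 0, by simp, by simpa using hzero 0⟩
  | succ n ih =>
    have hdiff : Differentiable ℝ g := by simpa using hg 0 n.succ_pos
    have hrolle (i : Fin (n + 1)) :
        ∃ w ∈ Set.Ioo (z i.castSucc) (z i.succ), deriv g w = 0 :=
      exists_deriv_eq_zero (hz i.castSucc_lt_succ) hdiff.continuous.continuousOn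
        (by rw [hzero, hzero])
    choose w hw hw0 using hrolle
    have hwmono : StrictMono w := by
      intro i j hij
      have hij' : i.succ ≤ j.castSucc := by
        rw [Fin.le_def]
        simpa using hij
      exact (hw i).2.trans_le ((hz.monotone hij').trans (hw j).1.le)
    obtain ⟨ξ, hξ, hξ0⟩ := ih (deriv g)
      (fun k hk => by simpa only [iteratedDeriv_succ'] using hg (k + 1) (by lia)) w hwmono hw0
    refine ⟨ξ, ⟨?_, ?_⟩, by rwa [iteratedDeriv_succ']⟩
    · simpa using (hw 0).1.le.trans hξ.1
    · simpa using hξ.2.trans (hw (Fin.last n)).2.le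

theorem iteratedDeriv_sub_polynomial_eval (n : ℕ) (f : ℝ → ℝ)
    (hf : ∀ k < n, Differentiable ℝ (iteratedDeriv k f)) (P : Polynomial ℝ) :
    iteratedDeriv n (fun t => f t - P.eval t) =
      fun t => iteratedDeriv n f t - (Polynomial.derivative^[n] P).eval t := by
  induction n with
  | zero => simp
  | succ n ih =>
    rw [iteratedDeriv_succ, ih fun k hk => hf k (by lia)]
    funext t
    rw [deriv_fun_sub (hf n n.lt_succ_self t) (Polynomial.differentiableAt _),
      Polynomial.deriv, iteratedDeriv_succ, Function.iterate_succ_apply']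

theorem iterate_derivative_prod_X_sub_C (n : ℕ) (x : Fin n → ℝ) :
    Polynomial.derivative^[n] (∏ i, (Polynomial.X - Polynomial.C (x i))) =
      Polynomial.C (n.factorial : ℝ) := by
  have hmonic : (∏ i, (Polynomial.X - Polynomial.C (x i))).Monic :=
    Polynomial.monic_prod_X_sub_C x Finset.univ
  have hdeg : (∏ i, (Polynomial.X - Polynomial.C (x i))).natDegree = n := by simp
  have hcoeff := hmonic.coeff_natDegree
  rw [hdeg] at hcoeff
  rw [Polynomial.eq_C_of_natDegree_eq_zero (p := Polynomial.derivative^[n] _)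
    (by have := Polynomial.natDegree_iterate_derivative
          (∏ i, (Polynomial.X - Polynomial.C (x i))) n
        lia), Polynomial.coeff_iterate_derivative]
  simp [hcoeff, Nat.descFactorial_self]

/-- Error term for Lagrange interpolation at a point to the right of all nodes:
if `f` is `n` times differentiable, `x 0 < x 1 < … < x (n-1)` are the interpolation
nodes, `y` lies strictly to the right of all of them, and `π` is the (unique)
polynomial of degree at most `n − 1` interpolating `f` at the nodes, then there is
`ξ ∈ [x 0, y]` with `f(y) − π(y) = ω(y) · f⁽ⁿ⁾(ξ) / n!`, where `ω(t) = ∏ (t − x i)`. -/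
theorem interpolation_error (n : ℕ) (hn : 1 ≤ n) (f : ℝ → ℝ)
    (hf : ∀ k < n, Differentiable ℝ (iteratedDeriv k f))
    (x : Fin n → ℝ) (hx : StrictMono x) (y : ℝ) (hy : ∀ i, x i < y)
    (π : Polynomial ℝ) (hdeg : π.degree < n)
    (hinterp : ∀ i, π.eval (x i) = f (x i)) :
    ∃ ξ ∈ Set.Icc (x ⟨0, hn⟩) y,
      f y - π.eval y = (∏ i, (y - x i)) * iteratedDeriv n f ξ / n.factorial := by
  set ω : Polynomial ℝ := ∏ i, (Polynomial.X - Polynomial.C (x i)) with hω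
  have hωeval (t : ℝ) : ω.eval t = ∏ i, (t - x i) := by
    simp [hω, Polynomial.eval_prod]
  have hωy : ω.eval y ≠ 0 := by
    rw [hωeval]
    exact Finset.prod_ne_zero_iff.mpr fun i _ => sub_ne_zero.mpr (hy i).ne'
  have hωx (i : Fin n) : ω.eval (x i) = 0 := by
    rw [hωeval]
    exact Finset.prod_eq_zero (Finset.mem_univ i) (sub_self _)
  set c : ℝ := (f y - π.eval y) / ω.eval y with hc
  set P : Polynomial ℝ := π + Polynomial.C c * ω with hP
  have hderiv (k : ℕ) (hk : k ≤ n) := iteratedDeriv_sub_polynomial_eval k f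
    (fun j hj => hf j (by lia)) P
  have hPn : Polynomial.derivative^[n] P = Polynomial.C (c * n.factorial) := by
    rw [hP, iterate_map_add, Polynomial.iterate_derivative_C_mul,
      iterate_derivative_prod_X_sub_C, Polynomial.iterate_derivative_eq_zero_of_degree_lt hdeg,
      zero_add, Polynomial.C_mul]
  obtain ⟨ξ, hξ, hξ0⟩ := exists_iteratedDeriv_eq_zero n (fun t => f t - P.eval t)
    (fun k hk => by
      rw [hderiv k hk.le]
      exact (hf k hk).sub (Polynomial.differentiable _))
    (Fin.snoc x y : Fin (n + 1) → ℝ)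
    (by
      intro i j hij
      induction j using Fin.lastCases with
      | last =>
        induction i using Fin.lastCases with
        | last => exact absurd hij (lt_irrefl _)
        | cast i => simpa using hy i
      | cast j =>
        induction i using Fin.lastCases with
        | last => exact absurd hij (Fin.le_last _).not_gt
        | cast i => simpa using hx (by simpa using hij))
    (by
      intro i
      induction i using Fin.lastCases with
      | last =>
        simp only [Fin.snoc_last, hP, Polynomial.eval_add, Polynomial.eval_mul,
          Polynomial.eval_C, hc, div_mul_cancel₀ _ hωy]
        ring
      | cast i => simp [hP, hωx, hinterp])
  have hzero : (Fin.snoc x y : Fin (n + 1) → ℝ) 0 = x ⟨0, hn⟩ :=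
    Fin.snoc_castSucc (α := fun _ => ℝ) y x ⟨0, hn⟩
  rw [hzero, Fin.snoc_last] at hξ
  refine ⟨ξ, hξ, ?_⟩
  simp only [hderiv n le_rfl, hPn, Polynomial.eval_C, sub_eq_zero] at hξ0
  rw [hξ0, ← hωeval, hc]
  field_simp
end

section
/- Let j ∈ ℕ, let f : ℝ → ℝ be j times continuously differentiable, let n ≥ 1, and let x ∈ [0,1]. Then there exist points ξ_0, …, ξ_n with ξ_k ∈ [k/(n+j), (k+j)/(n+j)] for each k, such that the j-th derivative of the Bernstein polynomial B_{n+j}(f) at x equals ((n+j)!/(n!·(n+j)^j)) · Σ_{k=0}^{n} C(n,k) · f^{(j)}(ξ_k) · x^k · (1−x)^{n−k}. -/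
/-- The `n`-th Bernstein polynomial of `f : ℝ → ℝ`. -/
noncomputable def bern (n : ℕ) (f : ℝ → ℝ) (x : ℝ) : ℝ :=
  ∑ k ∈ Finset.range (n + 1), (n.choose k : ℝ) * f ((k : ℝ) / n) * x ^ k * (1 - x) ^ (n - k)

/-- The Bernstein sum of degree `n` with coefficients `a 0, …, a n`. -/
noncomputable def bernsteinSum (n : ℕ) (a : ℕ → ℝ) (x : ℝ) : ℝ :=
  ∑ k ∈ Finset.range (n + 1), (n.choose k : ℝ) * (a k * x ^ k * (1 - x) ^ (n - k))

lemma bernsteinSum_succ (n : ℕ) (a : ℕ → ℝ) (x : ℝ) :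
    bernsteinSum (n + 1) a x
      = (1 - x) * bernsteinSum n a x + x * bernsteinSum n (fun k => a (k + 1)) x := by
  have h := Finset.sum_choose_succ_mul (fun i l => a i * x ^ i * (1 - x) ^ l) n
  unfold bernsteinSum
  rw [h, Finset.mul_sum, Finset.mul_sum]
  congr 1 <;> refine Finset.sum_congr rfl fun k hk => ?_
  · rw [Nat.succ_sub (Finset.mem_range_succ_iff.mp hk), pow_succ]
    ring
  · ring

lemma bernsteinSum_fwdDiff (n : ℕ) (a : ℕ → ℝ) (x : ℝ) :
    bernsteinSum n (fwdDiff 1 a) x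
      = bernsteinSum n (fun k => a (k + 1)) x - bernsteinSum n a x := by
  simp only [bernsteinSum, fwdDiff, ← Finset.sum_sub_distrib]
  exact Finset.sum_congr rfl fun k _ => by ring

lemma hasDerivAt_bernsteinSum_succ (n : ℕ) (a : ℕ → ℝ) (x : ℝ) :
    HasDerivAt (bernsteinSum (n + 1) a) ((n + 1) * bernsteinSum n (fwdDiff 1 a) x) x := by
  induction n generalizing a with
  | zero =>
    have h : bernsteinSum (0 + 1) a = fun y => (1 - y) * a 0 + y * a 1 := by
      ext y
      rw [bernsteinSum_succ]
      simp [bernsteinSum]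
    rw [h]
    refine ((((hasDerivAt_id x).const_sub 1).mul_const (a 0)).add
      ((hasDerivAt_id x).mul_const (a 1))).congr_deriv ?_
    simp [bernsteinSum, fwdDiff]
    ring
  | succ n ih =>
    rw [funext (bernsteinSum_succ (n + 1) a)]
    refine ((((hasDerivAt_id x).const_sub 1).mul (ih a)).add
      ((hasDerivAt_id x).mul (ih fun k => a (k + 1)))).congr_deriv ?_
    have h₁ := bernsteinSum_fwdDiff (n + 1) a x
    have h₂ := bernsteinSum_succ n (fwdDiff 1 a) x
    change _ = _ + x * bernsteinSum n (fwdDiff 1 fun k => a (k + 1)) x at h₂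
    simp only [id, Nat.cast_add, Nat.cast_one]
    linear_combination -((n : ℝ) + 1) * h₂ - h₁

lemma iteratedDeriv_bernsteinSum (j n : ℕ) (a : ℕ → ℝ) (x : ℝ) :
    iteratedDeriv j (bernsteinSum (n + j) a) x
      = ((n + j).factorial : ℝ) / n.factorial * bernsteinSum n ((fwdDiff 1)^[j] a) x := by
  induction j generalizing a with
  | zero => simp [Nat.factorial_ne_zero]
  | succ j ih =>
    have h : deriv (bernsteinSum (n + (j + 1)) a)
        = fun y => ((n + j : ℕ) + 1 : ℝ) * bernsteinSum (n + j) (fwdDiff 1 a) y :=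
      funext fun y => (hasDerivAt_bernsteinSum_succ (n + j) a y).deriv
    rw [iteratedDeriv_succ', h, iteratedDeriv_const_mul_field, ih, Function.iterate_succ_apply,
      ← add_assoc, Nat.factorial_succ]
    push_cast
    ring

/-- Mean value theorem for iterated forward differences. -/
lemma exists_fwdDiff_iter_eq_iteratedDeriv {j : ℕ} {f : ℝ → ℝ} (hf : ContDiff ℝ j f)
    {h : ℝ} (hh : 0 < h) (x : ℝ) :
    ∃ ξ ∈ Set.Icc x (x + j * h), (fwdDiff h)^[j] f x = h ^ j * iteratedDeriv j f ξ := by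
  induction j generalizing f with
  | zero => exact ⟨x, by simp, by simp⟩
  | succ j ih =>
    have hfj : ContDiff ℝ j f := hf.of_le (by exact_mod_cast j.le_succ)
    have hshift : ContDiff ℝ j fun y => f (y + h) := hfj.comp (contDiff_id.add contDiff_const)
    obtain ⟨η, hη, hηe⟩ := ih (f := fwdDiff h f) (hshift.sub hfj)
    have hdiff : Differentiable ℝ (iteratedDeriv j f) :=
      hf.differentiable_iteratedDeriv j (by exact_mod_cast j.lt_succ_self)
    obtain ⟨ξ, hξ, hξe⟩ := exists_deriv_eq_slope (iteratedDeriv j f) (lt_add_of_pos_right η hh)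
      hdiff.continuous.continuousOn hdiff.differentiableOn
    refine ⟨ξ, ⟨hη.1.trans hξ.1.le, ?_⟩, ?_⟩
    · have := hη.2
      have := hξ.2
      push_cast
      linarith
    · have hsub : iteratedDeriv j (fwdDiff h f) η
          = iteratedDeriv j f (η + h) - iteratedDeriv j f η := by
        have := iteratedDeriv_sub (x := η) hshift.contDiffAt hfj.contDiffAt
        rwa [iteratedDeriv_comp_add_const] at this
      rw [Function.iterate_succ_apply, hηe, hsub, iteratedDeriv_succ, hξe, add_sub_cancel_left]
      field_simp
      ring

lemma fwdDiff_iter_comp_mul (f : ℝ → ℝ) (h : ℝ) (j k : ℕ) :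
    (fwdDiff 1)^[j] (fun i : ℕ => f (i * h)) k = (fwdDiff h)^[j] f (k * h) := by
  rw [fwdDiff_iter_eq_sum_shift, fwdDiff_iter_eq_sum_shift]
  refine Finset.sum_congr rfl fun i _ => ?_
  simp [add_mul]

/-- If `f` is `j` times continuously differentiable, `n ≥ 1` and `x ∈ [0,1]`, then there are
points `ξ_k ∈ [k/(n+j), (k+j)/(n+j)]` with
`(d^j/dx^j) B_{n+j}(f)(x) = ((n+j)!/(n!·(n+j)^j)) Σ_{k=0}^n C(n,k) f⁽ʲ⁾(ξ_k) x^k (1−x)^{n−k}`. -/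
theorem iteratedDeriv_bernstein (j : ℕ) (f : ℝ → ℝ) (hf : ContDiff ℝ (j : ℕ∞) f)
    (n : ℕ) (hn : 1 ≤ n) (x : ℝ) (hx : x ∈ Set.Icc (0 : ℝ) 1) :
    ∃ ξ : ℕ → ℝ, (∀ k ≤ n, ξ k ∈ Set.Icc ((k : ℝ) / ((n : ℝ) + j) ) (((k : ℝ) + j) / ((n : ℝ) + j))) ∧
      iteratedDeriv j (bern (n + j) f) x
        = ((n + j).factorial : ℝ) / ((n.factorial : ℝ) * ((n : ℝ) + j) ^ j) *
            ∑ k ∈ Finset.range (n + 1),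
              (n.choose k : ℝ) * iteratedDeriv j f (ξ k) * x ^ k * (1 - x) ^ (n - k) := by
  have hN : (0 : ℝ) < (n : ℝ) + j := by positivity
  have hmean (k : ℕ) := exists_fwdDiff_iter_eq_iteratedDeriv (j := j) (by exact_mod_cast hf)
    (inv_pos.mpr hN) (k * ((n : ℝ) + j)⁻¹)
  choose ξ hξ hξe using hmean
  refine ⟨ξ, fun k _ => ?_, ?_⟩
  · rw [add_div, div_eq_mul_inv, div_eq_mul_inv]
    exact hξ k
  · have hbern : bern (n + j) f
        = bernsteinSum (n + j) fun k => f (k * ((n : ℝ) + j)⁻¹) := by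
      ext y
      simp only [bern, bernsteinSum, div_eq_mul_inv, mul_assoc, Nat.cast_add]
    rw [hbern, iteratedDeriv_bernsteinSum, bernsteinSum, Finset.mul_sum, Finset.mul_sum]
    refine Finset.sum_congr rfl fun k _ => ?_
    rw [fwdDiff_iter_comp_mul, hξe, inv_pow]
    field_simp
end

section
/- Let j ∈ ℕ and let f : ℝ → ℝ be j times continuously differentiable. Then for every n ≥ 1, the supremum over x ∈ [0,1] of the absolute value of the j-th derivative of the Bernstein polynomial B_{n+j}(f) at x is at most the supremum over x ∈ [0,1] of |f^{(j)}(x)|. -/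
open Polynomial in
/-- The polynomial with coefficients `a 0, …, a n` in the Bernstein basis of degree `n`. -/
noncomputable def bernsteinForm (n : ℕ) (a : ℕ → ℝ) : ℝ[X] :=
  ∑ k ∈ Finset.range (n + 1), C (a k) * bernsteinPolynomial ℝ n k

lemma eval_bernsteinForm (n : ℕ) (a : ℕ → ℝ) (x : ℝ) :
    (bernsteinForm n a).eval x =
      ∑ k ∈ Finset.range (n + 1), a k * (bernsteinPolynomial ℝ n k).eval x := by
  simp [bernsteinForm, Polynomial.eval_finsetSum]

lemma bern_eq_eval_bernsteinForm (n : ℕ) (f : ℝ → ℝ) :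
    bern n f = fun x => (bernsteinForm n fun k => f (k * (1 / n))).eval x := by
  funext x
  rw [eval_bernsteinForm, bern]
  refine Finset.sum_congr rfl fun k _ => ?_
  simp only [bernsteinPolynomial, Polynomial.eval_mul, Polynomial.eval_natCast,
    Polynomial.eval_pow, Polynomial.eval_X, Polynomial.eval_sub, Polynomial.eval_one,
    mul_one_div]
  ring

open Polynomial in
lemma derivative_bernsteinForm (n : ℕ) (a : ℕ → ℝ) :
    derivative (bernsteinForm (n + 1) a) = C (n + 1 : ℝ) * bernsteinForm n (fwdDiff 1 a) := by
  have shift : ∑ k ∈ Finset.range (n + 1), C (a (k + 1)) * bernsteinPolynomial ℝ n (k + 1)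
      + C (a 0) * bernsteinPolynomial ℝ n 0
      = ∑ k ∈ Finset.range (n + 1), C (a k) * bernsteinPolynomial ℝ n k := by
    rw [← Finset.sum_range_succ' fun k => C (a k) * bernsteinPolynomial ℝ n k,
      Finset.sum_range_succ, bernsteinPolynomial.eq_zero_of_lt ℝ n.lt_succ_self, mul_zero,
      add_zero]
  have expand : derivative (bernsteinForm (n + 1) a) = C (n + 1 : ℝ) *
      (∑ k ∈ Finset.range (n + 1), C (a (k + 1)) * bernsteinPolynomial ℝ n k
        - (∑ k ∈ Finset.range (n + 1), C (a (k + 1)) * bernsteinPolynomial ℝ n (k + 1)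
          + C (a 0) * bernsteinPolynomial ℝ n 0)) := by
    rw [bernsteinForm, Finset.sum_range_succ', ← sub_sub, ← Finset.sum_sub_distrib, mul_sub,
      Finset.mul_sum, derivative_add, derivative_sum, sub_eq_add_neg]
    congr 1
    · refine Finset.sum_congr rfl fun k _ => ?_
      rw [derivative_C_mul, bernsteinPolynomial.derivative_succ_aux]
      simp only [map_add, map_natCast, map_one]
      ring
    · rw [derivative_C_mul, bernsteinPolynomial.derivative_zero]
      simp only [map_add, map_natCast, map_one, Nat.add_sub_cancel, Nat.cast_add, Nat.cast_one]
      ring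
  rw [expand, shift, ← Finset.sum_sub_distrib, bernsteinForm]
  refine congrArg _ (Finset.sum_congr rfl fun k _ => ?_)
  rw [fwdDiff, map_sub, sub_mul]

lemma iteratedDeriv_bernsteinForm (j n : ℕ) (a : ℕ → ℝ) :
    iteratedDeriv j (fun x => (bernsteinForm (n + j) a).eval x) =
      fun x => ((n + j).descFactorial j : ℝ) *
        (bernsteinForm n ((fwdDiff 1)^[j] a)).eval x := by
  induction j generalizing a with
  | zero => simp
  | succ j ih =>
    have hd : deriv (fun x => (bernsteinForm (n + (j + 1)) a).eval x) =
        fun x => ((n + j : ℕ) + 1 : ℝ) * (bernsteinForm (n + j) (fwdDiff 1 a)).eval x := by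
      funext x
      rw [Polynomial.deriv, ← add_assoc, derivative_bernsteinForm, Polynomial.eval_mul,
        Polynomial.eval_C]
    rw [iteratedDeriv_succ', hd]
    funext x
    rw [iteratedDeriv_const_mul_field, ih, Function.iterate_succ_apply, ← add_assoc,
      Nat.succ_descFactorial_succ]
    push_cast
    ring

lemma bernsteinPolynomial_eval_nonneg (n k : ℕ) {x : ℝ} (hx : x ∈ Set.Icc (0 : ℝ) 1) :
    0 ≤ (bernsteinPolynomial ℝ n k).eval x := by
  have h0 : 0 ≤ x := hx.1
  have h1 : 0 ≤ 1 - x := sub_nonneg.2 hx.2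
  simp only [bernsteinPolynomial, Polynomial.eval_mul, Polynomial.eval_natCast,
    Polynomial.eval_pow, Polynomial.eval_X, Polynomial.eval_sub, Polynomial.eval_one]
  positivity

lemma abs_eval_bernsteinForm_le {n : ℕ} {a : ℕ → ℝ} {C x : ℝ} (ha : ∀ k ≤ n, |a k| ≤ C)
    (hx : x ∈ Set.Icc (0 : ℝ) 1) : |(bernsteinForm n a).eval x| ≤ C := by
  have hsum : ∑ k ∈ Finset.range (n + 1), (bernsteinPolynomial ℝ n k).eval x = 1 := by
    rw [← Polynomial.eval_finsetSum, bernsteinPolynomial.sum, Polynomial.eval_one]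
  calc |(bernsteinForm n a).eval x|
      ≤ ∑ k ∈ Finset.range (n + 1), |a k * (bernsteinPolynomial ℝ n k).eval x| := by
        rw [eval_bernsteinForm]
        exact Finset.abs_sum_le_sum_abs _ _
    _ ≤ ∑ k ∈ Finset.range (n + 1), C * (bernsteinPolynomial ℝ n k).eval x := by
        refine Finset.sum_le_sum fun k hk => ?_
        have hb := bernsteinPolynomial_eval_nonneg n k hx
        rw [abs_mul, abs_of_nonneg hb]
        exact mul_le_mul_of_nonneg_right (ha k (Nat.lt_succ_iff.1 (Finset.mem_range.1 hk))) hb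
    _ = C := by rw [← Finset.mul_sum, hsum, mul_one]

lemma iterate_fwdDiff_comp_natCast_mul (f : ℝ → ℝ) (h : ℝ) (j : ℕ) :
    (fwdDiff 1)^[j] (fun k : ℕ => f (k * h)) = fun k : ℕ => (fwdDiff h)^[j] f (k * h) := by
  induction j generalizing f with
  | zero => rfl
  | succ j ih =>
    have hstep : fwdDiff 1 (fun k : ℕ => f (k * h)) = fun k : ℕ => fwdDiff h f (k * h) := by
      funext k
      simp only [fwdDiff, Nat.cast_add, Nat.cast_one, add_one_mul]
    rw [Function.iterate_succ_apply, hstep, ih, Function.iterate_succ_apply]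

lemma abs_iterate_fwdDiff_le {j : ℕ} {f : ℝ → ℝ} (hf : ContDiff ℝ j f) {a h M : ℝ} (hh : 0 ≤ h)
    (hM : ∀ x ∈ Set.Icc a (a + j * h), |iteratedDeriv j f x| ≤ M) :
    |(fwdDiff h)^[j] f a| ≤ h ^ j * M := by
  induction j generalizing f M with
  | zero => simpa using hM a (by simp)
  | succ j ih =>
    have hfj : ContDiff ℝ j f := hf.of_le (by exact_mod_cast j.le_succ)
    have hshift : ContDiff ℝ j fun x => f (x + h) := hfj.comp (contDiff_id.add contDiff_const)
    have hbound : ∀ x ∈ Set.Icc a (a + j * h), |iteratedDeriv j (fwdDiff h f) x| ≤ h * M := by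
      intro x hx
      have hdiff : iteratedDeriv j (fwdDiff h f) x =
          iteratedDeriv j f (x + h) - iteratedDeriv j f x := by
        have := iteratedDeriv_sub (x := x) hshift.contDiffAt hfj.contDiffAt
        rw [iteratedDeriv_comp_add_const] at this
        exact this
      have hmvt := (convex_Icc x (x + h)).norm_image_sub_le_of_norm_deriv_le
        (f := iteratedDeriv j f) (C := M)
        (fun y _ => hf.differentiable_iteratedDeriv' j y)
        (fun y hy => by
          rw [← iteratedDeriv_succ, Real.norm_eq_abs]
          refine hM y ⟨hx.1.trans hy.1, hy.2.trans ?_⟩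
          push_cast
          linarith [hx.2])
        (Set.left_mem_Icc.2 (by linarith)) (Set.right_mem_Icc.2 (by linarith))
      rw [hdiff]
      simpa [abs_of_nonneg hh, mul_comm] using hmvt
    rw [Function.iterate_succ_apply, pow_succ, mul_assoc]
    exact ih (hshift.sub hfj) hbound

/-- If `f` is `j` times continuously differentiable, then for every `n ≥ 1`,
`sup_{x ∈ [0,1]} |(d^j/dx^j) B_{n+j}(f)(x)| ≤ sup_{x ∈ [0,1]} |f⁽ʲ⁾(x)|`. -/
theorem iteratedDeriv_bernstein_bound (j : ℕ) (f : ℝ → ℝ) (hf : ContDiff ℝ (j : ℕ∞) f)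
    (n : ℕ) (hn : 1 ≤ n) :
    (⨆ x : Set.Icc (0 : ℝ) 1, |iteratedDeriv j (bern (n + j) f) x|)
      ≤ ⨆ x : Set.Icc (0 : ℝ) 1, |iteratedDeriv j f x| := by
  have hfj : ContDiff ℝ j f := by exact_mod_cast hf
  have hcont : Continuous fun x : Set.Icc (0 : ℝ) 1 => |iteratedDeriv j f x| :=
    ((hfj.continuous_iteratedDeriv' j).comp continuous_subtype_val).abs
  have hbdd : BddAbove (Set.range fun x : Set.Icc (0 : ℝ) 1 => |iteratedDeriv j f x|) :=
    (isCompact_range hcont).bddAbove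
  set M := ⨆ x : Set.Icc (0 : ℝ) 1, |iteratedDeriv j f x|
  have hM : ∀ x ∈ Set.Icc (0 : ℝ) 1, |iteratedDeriv j f x| ≤ M :=
    fun x hx => le_ciSup hbdd ⟨x, hx⟩
  have hM0 : 0 ≤ M := (abs_nonneg _).trans (hM 0 (by simp))
  have hN : (0 : ℝ) < (n + j : ℕ) := by exact_mod_cast (by omega : 0 < n + j)
  have hdiff : ∀ k ≤ n, |(fwdDiff 1)^[j] (fun k : ℕ => f (k * (1 / (n + j : ℕ)))) k| ≤
      (1 / (n + j : ℕ)) ^ j * M := by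
    intro k hk
    rw [iterate_fwdDiff_comp_natCast_mul]
    refine abs_iterate_fwdDiff_le hfj (by positivity) fun x hx => hM x ⟨?_, hx.2.trans ?_⟩
    · exact le_trans (by positivity) hx.1
    · rw [← add_mul, mul_one_div, div_le_one hN]
      exact_mod_cast Nat.add_le_add_right hk j
  refine ciSup_le fun x => ?_
  rw [bern_eq_eval_bernsteinForm, iteratedDeriv_bernsteinForm, abs_mul, Nat.abs_cast]
  calc ((n + j).descFactorial j : ℝ) * |(bernsteinForm n _).eval (x : ℝ)|
      ≤ ((n + j : ℕ) : ℝ) ^ j * ((1 / (n + j : ℕ)) ^ j * M) := by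
        gcongr
        · exact_mod_cast Nat.descFactorial_le_pow (n + j) j
        · exact abs_eval_bernsteinForm_le hdiff x.2
    _ = M := by rw [← mul_assoc, ← mul_pow, mul_one_div_cancel hN.ne', one_pow, one_mul]
end

section
/- Let d ≥ 1, let β ∈ ℕ^d be a multiindex, and let f : ℝ^d → ℝ be such that all mixed partial derivatives ∂^γ f for γ ≤ β exist and are continuous. Then the family of functions ( ∂^β B_α(f) )_{α ∈ ℕ^d, α_i > β_i for all i}, restricted to [0,1]^d, is equicontinuous. -/
/-- Partial derivative in the `i`-th coordinate. -/
noncomputable def partialDeriv (d : ℕ) (i : Fin d) (f : (Fin d → ℝ) → ℝ) :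
    (Fin d → ℝ) → ℝ :=
  fun x => deriv (fun t => f (Function.update x i t)) (x i)

/-- The mixed partial derivative `∂^β = ∂^{β 0}_{x_0} ⋯ ∂^{β (d-1)}_{x_{d-1}}`. -/
noncomputable def mixedPartial (d : ℕ) (β : Fin d → ℕ) (f : (Fin d → ℝ) → ℝ) :
    (Fin d → ℝ) → ℝ :=
  (List.finRange d).foldr (fun i g => (partialDeriv d i)^[β i] g) f

/-- The multivariate Bernstein polynomial `B_α(f)`. -/
noncomputable def multiBernstein (d : ℕ) (α : Fin d → ℕ) (f : (Fin d → ℝ) → ℝ)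
    (x : Fin d → ℝ) : ℝ :=
  ∑ β : (i : Fin d) → Fin (α i + 1),
    (∏ i, ((α i).choose (β i) : ℝ)) * f (fun i => ((β i : ℕ) : ℝ) / (α i : ℝ)) *
      ∏ i, (x i) ^ (β i : ℕ) * (1 - x i) ^ (α i - (β i : ℕ))

/-- `f` has all mixed partial derivatives `∂^γ f` for `γ ≤ β`, and they are continuous. -/
def HasContMixedPartials (d : ℕ) (β : Fin d → ℕ) (f : (Fin d → ℝ) → ℝ) : Prop :=
  ∀ γ : Fin d → ℕ, γ ≤ β →
    Continuous (mixedPartial d γ f) ∧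
    ∀ i : Fin d, γ i < β i → ∀ x : Fin d → ℝ,
      DifferentiableAt ℝ (fun t => mixedPartial d γ f (Function.update x i t)) (x i)


section BernsteinFunctional

variable {R : Type*} [CommRing R] [Algebra ℝ R] (L : R →ₗ[ℝ] ℝ)

lemma hasDerivAt_linearMap_one_add_smul_pow (w : R) (m : ℕ) (Q : R) (t : ℝ) :
    HasDerivAt (fun s : ℝ => L ((1 + s • w) ^ m * Q))
      (m * L ((1 + t • w) ^ (m - 1) * (w * Q))) t := by
  induction m generalizing Q with
  | zero => simpa using hasDerivAt_const t (L Q)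
  | succ m ih =>
    have hsplit : (fun s : ℝ => L ((1 + s • w) ^ (m + 1) * Q)) =
        fun s => L ((1 + s • w) ^ m * Q) + s * L ((1 + s • w) ^ m * (w * Q)) := by
      funext s
      rw [← smul_eq_mul s, ← map_smul, ← map_add]
      congr 1
      simp only [Algebra.smul_def]
      ring
    rw [hsplit]
    refine ((ih Q).add ((hasDerivAt_id t).mul (ih (w * Q)))).congr_deriv ?_
    rcases m with _ | m
    · simp
    · have hstep : L ((1 + t • w) ^ (m + 1) * (w * Q)) =
          L ((1 + t • w) ^ m * (w * Q)) + t * L ((1 + t • w) ^ m * (w * (w * Q))) := by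
        rw [← smul_eq_mul t, ← map_smul, ← map_add]
        congr 1
        simp only [Algebra.smul_def]
        ring
      simp only [Nat.add_sub_cancel, id, hstep]
      push_cast
      ring

variable {d : ℕ} (w : Fin d → R)

/-- The product `∏ⱼ (1 + xⱼ wⱼ) ^ mⱼ`. -/
noncomputable def bernsteinProd (m : Fin d → ℕ) (x : Fin d → ℝ) : R :=
  ∏ j, (1 + x j • w j) ^ m j

lemma bernsteinProd_update (m : Fin d → ℕ) (x : Fin d → ℝ) (i : Fin d) (k : ℕ) (t : ℝ) :
    bernsteinProd w (Function.update m i k) (Function.update x i t) =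
      (1 + t • w i) ^ k * ∏ j ∈ Finset.univ.erase i, (1 + x j • w j) ^ m j := by
  rw [bernsteinProd, ← Finset.mul_prod_erase _ _ (Finset.mem_univ i)]
  simp only [Function.update_self]
  congr 1
  refine Finset.prod_congr rfl fun j hj => ?_
  simp [Function.update_of_ne (Finset.ne_of_mem_erase hj)]

lemma partialDeriv_bernsteinProd (m : Fin d → ℕ) (Q : R) (c : ℝ) (i : Fin d) :
    partialDeriv d i (fun x => c * L (bernsteinProd w m x * Q)) =
      fun x => c * m i *
        L (bernsteinProd w (Function.update m i (m i - 1)) x * (w i * Q)) := by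
  funext x
  have h1 : (fun t => c * L (bernsteinProd w m (Function.update x i t) * Q)) = fun t =>
      c * L ((1 + t • w i) ^ m i *
        ((∏ j ∈ Finset.univ.erase i, (1 + x j • w j) ^ m j) * Q)) := by
    funext t
    have := bernsteinProd_update w m x i (m i) t
    rw [Function.update_eq_self] at this
    rw [this, mul_assoc]
  have h2 := bernsteinProd_update w m x i (m i - 1) (x i)
  rw [Function.update_eq_self] at h2
  rw [partialDeriv, h1, h2,
    ((hasDerivAt_linearMap_one_add_smul_pow L (w i) (m i) _ (x i)).const_mul c).deriv, mul_assoc]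
  congr 3
  ring

lemma iterate_partialDeriv_bernsteinProd (m : Fin d → ℕ) (Q : R) (c : ℝ) (i : Fin d) (r : ℕ) :
    (partialDeriv d i)^[r] (fun x => c * L (bernsteinProd w m x * Q)) =
      fun x => c * (m i).descFactorial r *
        L (bernsteinProd w (Function.update m i (m i - r)) x * (w i ^ r * Q)) := by
  induction r with
  | zero => simp
  | succ r ih =>
    rw [Function.iterate_succ_apply', ih, partialDeriv_bernsteinProd]
    simp only [Function.update_self, Function.update_idem, Nat.descFactorial_succ, pow_succ',
      Nat.sub_sub, mul_assoc, Nat.cast_mul]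
    simp only [mul_left_comm]

/-- Mixed partial derivatives of `f` along the coordinates in a list, applied from the right. -/
noncomputable def listPartial (β : Fin d → ℕ) (l : List (Fin d)) (f : (Fin d → ℝ) → ℝ) :
    (Fin d → ℝ) → ℝ :=
  l.foldr (fun i g => (partialDeriv d i)^[β i] g) f

lemma listPartial_bernsteinProd (m β : Fin d → ℕ) (l : List (Fin d)) (hl : l.Nodup) :
    listPartial β l (fun x => L (bernsteinProd w m x)) = fun x =>
      (l.map fun i => ((m i).descFactorial (β i) : ℝ)).prod *
        L (bernsteinProd w (fun j => if j ∈ l then m j - β j else m j) x *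
          (l.map fun i => w i ^ β i).prod) := by
  induction l with
  | nil => simp [listPartial]
  | cons i l ih =>
    obtain ⟨hi, hl'⟩ := List.nodup_cons.1 hl
    have hcons (g : (Fin d → ℝ) → ℝ) :
        listPartial β (i :: l) g = (partialDeriv d i)^[β i] (listPartial β l g) := rfl
    rw [hcons, ih hl', iterate_partialDeriv_bernsteinProd]
    have hm : Function.update (fun j => if j ∈ l then m j - β j else m j) i (m i - β i) =
        fun j => if j ∈ i :: l then m j - β j else m j := by
      funext j
      by_cases hj : j = i
      · subst hj; simp
      · simp [hj]
    simp only [hi, if_false, List.map_cons, List.prod_cons]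
    rw [hm]
    funext x
    ring_nf

lemma mixedPartial_bernsteinProd (m β : Fin d → ℕ) (x : Fin d → ℝ) :
    mixedPartial d β (fun x => L (bernsteinProd w m x)) x =
      (∏ i, ((m i).descFactorial (β i) : ℝ)) *
        L (bernsteinProd w (m - β) x * ∏ i, w i ^ β i) := by
  have h := congrFun (listPartial_bernsteinProd L w m β _ (List.nodup_finRange d)) x
  simp only [List.mem_finRange, if_true, ← Fin.prod_univ_def] at h
  exact h

end BernsteinFunctional

section Evaluation

open AddMonoidAlgebra

/-- The linear functional on `ℝ[V]` sending the basis element of `v` to `f v`. -/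
noncomputable def evalFunctional {V : Type*} (f : V → ℝ) : AddMonoidAlgebra ℝ V →ₗ[ℝ] ℝ :=
  Finsupp.linearCombination ℝ f ∘ₗ (coeffLinearEquiv ℝ).toLinearMap

@[simp]
lemma evalFunctional_single {V : Type*} (f : V → ℝ) (v : V) (c : ℝ) :
    evalFunctional f (single v c) = c * f v := by
  simp [evalFunctional]

variable {d : ℕ}

lemma multiBernstein_eq_evalFunctional (α : Fin d → ℕ) (f : (Fin d → ℝ) → ℝ) (x : Fin d → ℝ) :
    multiBernstein d α f x = evalFunctional f
      (bernsteinProd (fun i => single (Pi.single i ((α i : ℝ)⁻¹)) 1 - 1) α x) := by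
  have hfactor (i : Fin d) :
      (1 + x i • (single (Pi.single i ((α i : ℝ)⁻¹)) (1 : ℝ) - 1) :
        AddMonoidAlgebra ℝ (Fin d → ℝ)) ^ α i =
      ∑ k : Fin (α i + 1), single (Pi.single i ((k : ℕ) / (α i : ℝ)))
        ((α i).choose k * (x i ^ (k : ℕ) * (1 - x i) ^ (α i - k))) := by
    have h1 : (1 + x i • (single (Pi.single i ((α i : ℝ)⁻¹)) (1 : ℝ) - 1) :
        AddMonoidAlgebra ℝ (Fin d → ℝ)) =
        single (Pi.single i ((α i : ℝ)⁻¹)) (x i) + single 0 (1 - x i) := by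
      rw [smul_sub, one_def, smul_single, smul_single, single_sub]
      simp only [smul_eq_mul, mul_one]
      abel
    rw [h1, add_pow, Finset.sum_range]
    refine Finset.sum_congr rfl fun k _ => ?_
    rw [single_pow, single_pow, single_mul_single, natCast_def, single_mul_single]
    congr 1
    · rw [smul_zero, add_zero, add_zero, ← Pi.single_smul]
      simp [div_eq_mul_inv]
    · ring
  rw [bernsteinProd, Finset.prod_congr rfl fun i _ => hfactor i, Fintype.prod_sum, map_sum,
    multiBernstein]
  refine Finset.sum_congr rfl fun k _ => ?_
  rw [prod_single, evalFunctional_single, Finset.univ_sum_single]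
  simp only [Finset.prod_mul_distrib]
  ring

/-- `f` is differentiable along the `i`-th coordinate at every point. -/
def DifferentiableAlong (i : Fin d) (f : (Fin d → ℝ) → ℝ) : Prop :=
  ∀ x : Fin d → ℝ, DifferentiableAt ℝ (fun t => f (Function.update x i t)) (x i)

lemma DifferentiableAlong.hasDerivAt {i : Fin d} {f : (Fin d → ℝ) → ℝ}
    (hf : DifferentiableAlong i f) (x : Fin d → ℝ) (t : ℝ) :
    HasDerivAt (fun s => f (x + Pi.single i s)) (partialDeriv d i f (x + Pi.single i t)) t := by
  have hupd (s : ℝ) : x + Pi.single i s = Function.update x i (x i + s) := by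
    funext j
    by_cases hj : j = i
    · subst hj; simp
    · simp [hj]
  have h := (hf (x + Pi.single i t)).hasDerivAt
  have h' : HasDerivAt (fun s => f (Function.update (x + Pi.single i t) i s))
      (partialDeriv d i f (x + Pi.single i t)) (x i + t) := by
    simpa [partialDeriv] using h
  refine (h'.comp_const_add (x i) t).congr_of_eventuallyEq (Filter.Eventually.of_forall fun s => ?_)
  simp only [hupd, Function.update_idem]

lemma DifferentiableAlong.hasDerivAt_evalFunctional {i : Fin d} {f : (Fin d → ℝ) → ℝ}
    (hf : DifferentiableAlong i f) (y : Fin d → ℝ) (Q : AddMonoidAlgebra ℝ (Fin d → ℝ)) (t : ℝ) :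
    HasDerivAt (fun s => evalFunctional f (single (y + Pi.single i s) 1 * Q))
      (evalFunctional (partialDeriv d i f) (single (y + Pi.single i t) 1 * Q)) t := by
  induction Q using AddMonoidAlgebra.induction_linear with
  | zero => simpa using hasDerivAt_const t (0 : ℝ)
  | add p q hp hq =>
    simp only [mul_add, map_add]
    exact hp.add hq
  | single v c =>
    simp only [single_mul_single, one_mul, evalFunctional_single, add_right_comm y]
    exact (hf.hasDerivAt (y + v) t).const_mul c

lemma exists_evalFunctional_mul_sub_one_eq {i : Fin d} {f : (Fin d → ℝ) → ℝ}
    (hf : DifferentiableAlong i f) (y : Fin d → ℝ) (Q : AddMonoidAlgebra ℝ (Fin d → ℝ))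
    {h : ℝ} (hh : 0 < h) :
    ∃ s ∈ Set.Icc 0 h,
      evalFunctional f (single y 1 * ((single (Pi.single i h) 1 - 1) * Q)) =
        h * evalFunctional (partialDeriv d i f) (single (y + Pi.single i s) 1 * Q) := by
  have hder := hf.hasDerivAt_evalFunctional y Q
  obtain ⟨s, hs, hslope⟩ := exists_hasDerivAt_eq_slope _ _ hh
    (fun t _ => (hder t).continuousAt.continuousWithinAt) (fun t _ => hder t)
  refine ⟨s, Set.Ioo_subset_Icc_self hs, ?_⟩
  rw [hslope, sub_zero, mul_div_cancel₀ _ hh.ne', Pi.single_zero, add_zero, ← map_sub]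
  congr 1
  rw [← mul_one (1 : ℝ), ← single_mul_single]
  simp only [mul_one]
  ring

lemma exists_evalFunctional_mul_sub_one_pow_eq {i : Fin d} {f : (Fin d → ℝ) → ℝ} (r : ℕ)
    (hf : ∀ s < r, DifferentiableAlong i ((partialDeriv d i)^[s] f)) (y : Fin d → ℝ)
    (Q : AddMonoidAlgebra ℝ (Fin d → ℝ)) {h : ℝ} (hh : 0 < h) :
    ∃ s ∈ Set.Icc 0 (r * h),
      evalFunctional f (single y 1 * ((single (Pi.single i h) 1 - 1) ^ r * Q)) =
        h ^ r * evalFunctional ((partialDeriv d i)^[r] f) (single (y + Pi.single i s) 1 * Q) := by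
  induction r generalizing f y with
  | zero => exact ⟨0, by simp⟩
  | succ r ih =>
    obtain ⟨s, hs, hs'⟩ := exists_evalFunctional_mul_sub_one_eq (hf 0 r.succ_pos) y
      ((single (Pi.single i h) 1 - 1) ^ r * Q) hh
    obtain ⟨s', hs₁, hs₂⟩ := ih (f := partialDeriv d i f)
      (fun k hk => hf (k + 1) (Nat.succ_lt_succ hk)) (y + Pi.single i s)
    refine ⟨s + s', ⟨add_nonneg hs.1 hs₁.1, ?_⟩, ?_⟩
    · push_cast
      linarith [hs.2, hs₁.2]
    · rw [pow_succ', mul_assoc]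
      simp only [Function.iterate_zero, id] at hs'
      rw [hs', hs₂, add_assoc, ← Pi.single_add, Function.iterate_succ_apply]
      ring

lemma exists_evalFunctional_mul_prod_eq (β : Fin d → ℕ) (f : (Fin d → ℝ) → ℝ)
    (l : List (Fin d)) (hl : l.Nodup)
    (hf : ∀ i l', (i :: l') <:+ l → ∀ s < β i,
      DifferentiableAlong i ((partialDeriv d i)^[s] (listPartial β l' f)))
    (y : Fin d → ℝ) (Q : AddMonoidAlgebra ℝ (Fin d → ℝ)) {h : Fin d → ℝ} (hh : ∀ i, 0 < h i) :
    ∃ s : Fin d → ℝ, (∀ i, 0 ≤ s i) ∧ (∀ i, s i ≤ if i ∈ l then β i * h i else 0) ∧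
      evalFunctional f (single y 1 *
        ((l.map fun i => (single (Pi.single i (h i)) 1 - 1) ^ β i).prod * Q)) =
        (l.map fun i => h i ^ β i).prod *
          evalFunctional (listPartial β l f) (single (y + s) 1 * Q) := by
  induction l generalizing Q with
  | nil => exact ⟨0, by simp [listPartial]⟩
  | cons i l ih =>
    obtain ⟨hi, hl'⟩ := List.nodup_cons.1 hl
    obtain ⟨s, hs₀, hs₁, hs⟩ := ih hl'
      (fun j l' hj => hf j l' (hj.trans (List.suffix_cons i l)))
      ((single (Pi.single i (h i)) 1 - 1) ^ β i * Q)
    obtain ⟨t, ht, ht'⟩ := exists_evalFunctional_mul_sub_one_pow_eq (β i)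
      (hf i l List.suffix_rfl) (y + s) Q (hh i)
    refine ⟨s + Pi.single i t, fun j => ?_, fun j => ?_, ?_⟩
    · have hnonneg : (0 : Fin d → ℝ) ≤ Pi.single i t := Pi.single_nonneg.2 ht.1
      exact add_nonneg (hs₀ j) (hnonneg j)
    · by_cases hj : j = i
      · subst hj
        have := hs₁ j
        simp only [hi, if_false] at this
        simp only [Pi.add_apply, Pi.single_eq_same, List.mem_cons_self, if_true]
        linarith [ht.2]
      · simpa [hj] using hs₁ j
    · have hcons : listPartial β (i :: l) f =
        (partialDeriv d i)^[β i] (listPartial β l f) := rfl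
      simp only [List.map_cons, List.prod_cons, hcons]
      rw [mul_assoc, mul_left_comm (_ ^ _), hs, ht', ← add_assoc]
      ring

lemma listPartial_congr {β γ : Fin d → ℕ} {l : List (Fin d)} (h : ∀ i ∈ l, β i = γ i)
    (f : (Fin d → ℝ) → ℝ) : listPartial β l f = listPartial γ l f := by
  induction l with
  | nil => rfl
  | cons i l ih =>
    simp only [List.forall_mem_cons] at h
    change (partialDeriv d i)^[β i] (listPartial β l f) =
      (partialDeriv d i)^[γ i] (listPartial γ l f)
    rw [ih h.2, h.1]

lemma listPartial_zero (l : List (Fin d)) (f : (Fin d → ℝ) → ℝ) :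
    listPartial 0 l f = f := by
  induction l with
  | nil => rfl
  | cons i l ih => exact ih

lemma HasContMixedPartials.differentiableAlong {β : Fin d → ℕ} {f : (Fin d → ℝ) → ℝ}
    (hf : HasContMixedPartials d β f) (i : Fin d) (l : List (Fin d))
    (hl : (i :: l) <:+ List.finRange d) (s : ℕ) (hs : s < β i) :
    DifferentiableAlong i ((partialDeriv d i)^[s] (listPartial β l f)) := by
  classical
  obtain ⟨p, hp⟩ := hl
  have hnd := List.nodup_finRange d
  rw [← hp, List.nodup_append, List.nodup_cons] at hnd
  obtain ⟨-, ⟨hil, -⟩, hdisj⟩ := hnd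
  set γ : Fin d → ℕ := fun j => if j = i then s else if j ∈ l then β j else 0 with hγ
  have hle : γ ≤ β := by
    intro j
    simp only [hγ]
    split_ifs with h1 h2
    · exact h1 ▸ hs.le
    · exact le_rfl
    · exact Nat.zero_le _
  have hγi : γ i = s := by simp [hγ]
  have key : mixedPartial d γ f = (partialDeriv d i)^[s] (listPartial β l f) := by
    have h1 : mixedPartial d γ f = listPartial γ p (listPartial γ (i :: l) f) := by
      rw [mixedPartial, ← hp, List.foldr_append]
      rfl
    have h2 : listPartial γ (i :: l) f = (partialDeriv d i)^[γ i] (listPartial γ l f) := rfl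
    rw [h1, listPartial_congr (γ := 0), listPartial_zero, h2, hγi, listPartial_congr]
    · intro j hj
      have : j ≠ i := fun h => hil (h ▸ hj)
      simp [hγ, this, hj]
    · intro j hj
      have h3 : j ≠ i := hdisj j hj i (by simp)
      have h4 : j ∉ l := fun h => hdisj j hj j (by simp [h]) rfl
      simp [hγ, h3, h4]
  have := (hf γ hle).2 i (hγi ▸ hs)
  rwa [key] at this

end Evaluation

section Coupling

open AddMonoidAlgebra

/-- `p` and `q` are the marginals of a finitely supported probability measure on pairs of points
of the box `[0, b]` whose expected distance is at most `c`. -/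
def Coupled {d : ℕ} (b : Fin d → ℝ) (c : ℝ) (p q : AddMonoidAlgebra ℝ (Fin d → ℝ)) : Prop :=
  ∃ (ι : Type) (_ : Fintype ι) (w : ι → ℝ) (v v' : ι → Fin d → ℝ),
    (∀ j, 0 ≤ w j) ∧ ∑ j, w j = 1 ∧ (∀ j, v j ∈ Set.Icc 0 b) ∧ (∀ j, v' j ∈ Set.Icc 0 b) ∧
      ∑ j, w j * ‖v j - v' j‖ ≤ c ∧
      p = ∑ j, single (v j) (w j) ∧ q = ∑ j, single (v' j) (w j)

namespace Coupled

variable {d : ℕ} {b b' : Fin d → ℝ} {c c' : ℝ} {p p' q q' : AddMonoidAlgebra ℝ (Fin d → ℝ)}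

lemma symm (h : Coupled b c p q) : Coupled b c q p := by
  obtain ⟨ι, _, w, v, v', h0, h1, hv, hv', hc, hp, hq⟩ := h
  refine ⟨ι, _, w, v', v, h0, h1, hv', hv, ?_, hq, hp⟩
  simpa only [norm_sub_rev] using hc

lemma one : Coupled (0 : Fin d → ℝ) 0 1 1 :=
  ⟨Unit, inferInstance, fun _ => 1, fun _ => 0, fun _ => 0, by simp, by simp, by simp, by simp,
    by simp, by simp [one_def], by simp [one_def]⟩

lemma mul (h : Coupled b c p q) (h' : Coupled b' c' p' q') :
    Coupled (b + b') (c + c') (p * p') (q * q') := by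
  obtain ⟨ι, _, w, v, u, hw, hw1, hv, hu, hc, rfl, rfl⟩ := h
  obtain ⟨ι', _, w', v', u', hw', hw1', hv', hu', hc', rfl, rfl⟩ := h'
  refine ⟨ι × ι', inferInstance, fun j => w j.1 * w' j.2, fun j => v j.1 + v' j.2,
    fun j => u j.1 + u' j.2, fun j => mul_nonneg (hw _) (hw' _), ?_,
    fun j => ⟨add_nonneg (hv _).1 (hv' _).1, add_le_add (hv _).2 (hv' _).2⟩,
    fun j => ⟨add_nonneg (hu _).1 (hu' _).1, add_le_add (hu _).2 (hu' _).2⟩, ?_, ?_, ?_⟩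
  · rw [Fintype.sum_prod_type, ← Fintype.sum_mul_sum, hw1, hw1', one_mul]
  · have hle : ∀ j : ι × ι', w j.1 * w' j.2 * ‖v j.1 + v' j.2 - (u j.1 + u' j.2)‖ ≤
        (w j.1 * ‖v j.1 - u j.1‖) * w' j.2 + w j.1 * (w' j.2 * ‖v' j.2 - u' j.2‖) := by
      intro j
      have hn : ‖v j.1 + v' j.2 - (u j.1 + u' j.2)‖ ≤ ‖v j.1 - u j.1‖ + ‖v' j.2 - u' j.2‖ := by
        rw [add_sub_add_comm]
        exact norm_add_le _ _
      have := mul_le_mul_of_nonneg_left hn (mul_nonneg (hw j.1) (hw' j.2))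
      linarith
    refine (Finset.sum_le_sum fun j _ => hle j).trans ?_
    rw [Finset.sum_add_distrib, Fintype.sum_prod_type, Fintype.sum_prod_type]
    dsimp only
    rw [← Fintype.sum_mul_sum, ← Fintype.sum_mul_sum, hw1, hw1', mul_one, one_mul]
    exact add_le_add hc hc'
  · rw [Fintype.sum_mul_sum, Fintype.sum_prod_type]
    simp only [single_mul_single]
  · rw [Fintype.sum_mul_sum, Fintype.sum_prod_type]
    simp only [single_mul_single]

lemma pow (h : Coupled b c p q) (m : ℕ) : Coupled (m • b) (m * c) (p ^ m) (q ^ m) := by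
  induction m with
  | zero => simpa using one
  | succ m ih =>
    rw [succ_nsmul, pow_succ, pow_succ, Nat.cast_succ, add_one_mul]
    exact ih.mul h

lemma prod {ι : Type*} (s : Finset ι) {b : ι → Fin d → ℝ} {c : ι → ℝ}
    {p q : ι → AddMonoidAlgebra ℝ (Fin d → ℝ)} (h : ∀ i ∈ s, Coupled (b i) (c i) (p i) (q i)) :
    Coupled (∑ i ∈ s, b i) (∑ i ∈ s, c i) (∏ i ∈ s, p i) (∏ i ∈ s, q i) := by
  classical
  induction s using Finset.induction_on with
  | empty => simpa using one
  | insert i s hi ih =>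
    simp only [Finset.sum_insert hi, Finset.prod_insert hi]
    exact (h i (Finset.mem_insert_self i s)).mul
      (ih fun j hj => h j (Finset.mem_insert_of_mem hj))

lemma one_add_smul (hb : 0 ≤ b) {x y : ℝ} (hx : x ∈ Set.Icc (0 : ℝ) 1)
    (hy : y ∈ Set.Icc (0 : ℝ) 1) :
    Coupled b (‖b‖ * |x - y|) (1 + x • (single b 1 - 1)) (1 + y • (single b 1 - 1)) := by
  wlog hxy : x ≤ y generalizing x y
  · rw [abs_sub_comm]
    exact (this hy hx (le_of_not_ge hxy)).symm
  have hsplit (s t r : ℝ) (h : s + t + r = 1) :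
      (1 + r • (single b 1 - 1) : AddMonoidAlgebra ℝ (Fin d → ℝ)) =
        single 0 s + single b r + single 0 t := by
    obtain rfl : s = 1 - t - r := by linarith
    rw [smul_sub, one_def, smul_single, smul_single, single_sub, single_sub]
    simp only [smul_eq_mul, mul_one]
    abel
  refine ⟨Fin 3, inferInstance, ![1 - y, x, y - x], ![0, b, 0], ![0, b, b], ?_, ?_, ?_, ?_, ?_,
    ?_, ?_⟩
  · simp [Fin.forall_fin_succ, hx.1, hy.2, hxy]
  · simp [Fin.sum_univ_three]
  · simp [Fin.forall_fin_succ, hb]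
  · simp [Fin.forall_fin_succ, hb]
  · rw [abs_sub_comm, abs_of_nonneg (sub_nonneg.2 hxy)]
    simp [Fin.sum_univ_three, mul_comm]
  · simpa [Fin.sum_univ_three] using hsplit (1 - y) (y - x) x (by ring)
  · have h1 := hsplit (1 - y) 0 y (by ring)
    rw [single_zero, add_zero] at h1
    simp only [Fin.sum_univ_three, h1, Matrix.cons_val, add_assoc, ← single_add]
    congr 2
    ring

lemma bernsteinProd {m : Fin d → ℕ} {h : Fin d → ℝ} (hh : ∀ i, 0 ≤ h i) {x y : Fin d → ℝ}
    (hx : x ∈ Set.Icc 0 1) (hy : y ∈ Set.Icc 0 1) :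
    Coupled (fun i => m i * h i) (∑ i, m i * (h i * |x i - y i|))
      (bernsteinProd (fun i => single (Pi.single i (h i)) 1 - 1) m x)
      (bernsteinProd (fun i => single (Pi.single i (h i)) 1 - 1) m y) := by
  have hcoord (i : Fin d) := (one_add_smul (b := Pi.single i (h i)) (Pi.single_nonneg.2 (hh i))
    ⟨hx.1 i, hx.2 i⟩ ⟨hy.1 i, hy.2 i⟩).pow (m i)
  convert prod Finset.univ fun i _ => hcoord i using 1
  · simp only [← Pi.single_smul, Finset.univ_sum_single, nsmul_eq_mul]
  · refine Finset.sum_congr rfl fun i _ => ?_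
    rw [Pi.norm_single, Real.norm_of_nonneg (hh i)]
  · rfl
  · rfl

lemma abs_sub_le {φ : AddMonoidAlgebra ℝ (Fin d → ℝ) →ₗ[ℝ] ℝ} {ε C : ℝ} (hC : 0 ≤ C)
    (hφ : ∀ v ∈ Set.Icc 0 b, ∀ v' ∈ Set.Icc 0 b,
      |φ (single v 1 - single v' 1)| ≤ ε + C * ‖v - v'‖)
    (h : Coupled b c p q) : |φ p - φ q| ≤ ε + C * c := by
  obtain ⟨ι, _, w, v, v', hw, hw1, hv, hv', hc, rfl, rfl⟩ := h
  have hterm (j : ι) : φ (single (v j) (w j)) - φ (single (v' j) (w j)) =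
      w j * φ (single (v j) 1 - single (v' j) 1) := by
    rw [← map_sub, ← smul_eq_mul, ← map_smul, smul_sub, smul_single, smul_single, smul_eq_mul,
      mul_one]
  rw [map_sum, map_sum, ← Finset.sum_sub_distrib]
  calc |∑ j, (φ (single (v j) (w j)) - φ (single (v' j) (w j)))|
      ≤ ∑ j, |φ (single (v j) (w j)) - φ (single (v' j) (w j))| := Finset.abs_sum_le_sum_abs _ _
    _ ≤ ∑ j, (ε * w j + C * (w j * ‖v j - v' j‖)) := by
        refine Finset.sum_le_sum fun j _ => ?_
        rw [hterm, abs_mul, abs_of_nonneg (hw j)]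
        have := mul_le_mul_of_nonneg_left (hφ _ (hv j) _ (hv' j)) (hw j)
        linarith
    _ = ε + C * ∑ j, w j * ‖v j - v' j‖ := by
        rw [Finset.sum_add_distrib, ← Finset.mul_sum, ← Finset.mul_sum, hw1, mul_one]
    _ ≤ ε + C * c := by gcongr

end Coupled

end Coupling

lemma IsCompact.exists_dist_le_add_mul_dist {X : Type*} [PseudoMetricSpace X] {K : Set X}
    (hK : IsCompact K) {g : X → ℝ} (hg : ContinuousOn g K) {ε : ℝ} (hε : 0 < ε) :
    ∃ C : ℝ, 0 ≤ C ∧ ∀ x ∈ K, ∀ y ∈ K, dist (g x) (g y) ≤ ε + C * dist x y := by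
  obtain ⟨δ, hδ, hδ'⟩ := Metric.uniformContinuousOn_iff.1
    (hK.uniformContinuousOn_of_continuous hg) ε hε
  obtain ⟨M, hM⟩ := Metric.isBounded_iff.1 (hK.image_of_continuousOn hg).isBounded
  refine ⟨|M| / δ, by positivity, fun x hx y hy => ?_⟩
  rcases lt_or_ge (dist x y) δ with hlt | hge
  · have := hδ' x hx y hy hlt
    have : 0 ≤ |M| / δ * dist x y := by positivity
    linarith
  · have h1 := hM (Set.mem_image_of_mem g hx) (Set.mem_image_of_mem g hy)
    have h2 : |M| ≤ |M| / δ * dist x y := by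
      rw [div_mul_eq_mul_div, le_div_iff₀ hδ]
      gcongr
    linarith [le_abs_self M]

section MixedPartial

open AddMonoidAlgebra

variable {d : ℕ} {β α : Fin d → ℕ} {f : (Fin d → ℝ) → ℝ}

lemma HasContMixedPartials.exists_evalFunctional_eq (hf : HasContMixedPartials d β f)
    {h : Fin d → ℝ} (hh : ∀ i, 0 < h i) (y : Fin d → ℝ) (Q : AddMonoidAlgebra ℝ (Fin d → ℝ)) :
    ∃ s ∈ Set.Icc 0 (fun i => β i * h i),
      evalFunctional f (single y 1 * ((∏ i, (single (Pi.single i (h i)) 1 - 1) ^ β i) * Q)) =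
        (∏ i, h i ^ β i) * evalFunctional (mixedPartial d β f) (single (y + s) 1 * Q) := by
  obtain ⟨s, hs₀, hs₁, hs⟩ := exists_evalFunctional_mul_prod_eq β f (List.finRange d)
    (List.nodup_finRange d) hf.differentiableAlong y Q hh
  refine ⟨s, ⟨hs₀, fun i => by simpa using hs₁ i⟩, ?_⟩
  rw [Fin.prod_univ_def, Fin.prod_univ_def]
  exact hs

lemma HasContMixedPartials.abs_sub_mixedPartial_multiBernstein_le
    (hf : HasContMixedPartials d β f) (hα : ∀ i, β i < α i) {ε C : ℝ} (hC : 0 ≤ C)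
    (hg : ∀ x ∈ Set.Icc (0 : Fin d → ℝ) 1, ∀ y ∈ Set.Icc (0 : Fin d → ℝ) 1,
      |mixedPartial d β f x - mixedPartial d β f y| ≤ ε + C * ‖x - y‖)
    {x y : Fin d → ℝ} (hx : x ∈ Set.Icc 0 1) (hy : y ∈ Set.Icc 0 1) :
    |mixedPartial d β (multiBernstein d α f) x - mixedPartial d β (multiBernstein d α f) y| ≤
      ε + C * (d * ‖x - y‖) := by
  have hα₀ (i : Fin d) : (0 : ℝ) < α i := Nat.cast_pos.2 ((Nat.zero_le _).trans_lt (hα i))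
  set h : Fin d → ℝ := fun i => (α i : ℝ)⁻¹ with h_def
  have hh (i : Fin d) : 0 < h i := inv_pos.2 (hα₀ i)
  set D : AddMonoidAlgebra ℝ (Fin d → ℝ) := ∏ i, (single (Pi.single i (h i)) 1 - 1) ^ β i
  set K : ℝ := ∏ i, ((α i).descFactorial (β i) : ℝ)
  have hK₀ : 0 ≤ K := Finset.prod_nonneg fun i _ => Nat.cast_nonneg _
  have hK₁ : K * ∏ i, h i ^ β i ≤ 1 := by
    rw [← Finset.prod_mul_distrib]
    refine Finset.prod_le_one (fun i _ => by have := hh i; positivity) fun i _ => ?_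
    rw [h_def, inv_pow, ← div_eq_mul_inv]
    exact div_le_one_of_le₀ (by exact_mod_cast Nat.descFactorial_le_pow _ _) (by positivity)
  set φ : AddMonoidAlgebra ℝ (Fin d → ℝ) →ₗ[ℝ] ℝ :=
    K • evalFunctional f ∘ₗ LinearMap.mulRight ℝ D
  have hφ (z : Fin d → ℝ) : mixedPartial d β (multiBernstein d α f) z =
      φ (bernsteinProd (fun i => single (Pi.single i (h i)) 1 - 1) (α - β) z) := by
    rw [funext (multiBernstein_eq_evalFunctional α f), mixedPartial_bernsteinProd]
    rfl
  have hbox (i : Fin d) : ((α - β) i : ℕ) * h i + β i * h i = 1 := by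
    rw [← add_mul, ← Nat.cast_add, Pi.sub_apply, Nat.sub_add_cancel (hα i).le]
    exact mul_inv_cancel₀ (hα₀ i).ne'
  have hdiff : ∀ v ∈ Set.Icc 0 (fun i => ((α - β) i : ℕ) * h i),
      ∀ v' ∈ Set.Icc 0 (fun i => ((α - β) i : ℕ) * h i),
      |φ (single v 1 - single v' 1)| ≤ ε + C * ‖v - v'‖ := by
    intro v hv v' hv'
    obtain ⟨s, hs, hs'⟩ := hf.exists_evalFunctional_eq hh v (1 - single (v' - v) 1)
    have hmem : ∀ u ∈ Set.Icc 0 (fun i => ((α - β) i : ℕ) * h i), u + s ∈ Set.Icc 0 1 :=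
      fun u hu => ⟨add_nonneg hu.1 hs.1, fun i => by
        have := add_le_add (hu.2 i) (hs.2 i)
        rwa [hbox i] at this⟩
    have hφv : φ (single v 1 - single v' 1) = (K * ∏ i, h i ^ β i) *
        (mixedPartial d β f (v + s) - mixedPartial d β f (v' + s)) := by
      have h1 : (single v 1 - single v' 1) * D =
          single v 1 * (D * (1 - single (v' - v) 1)) := by
        rw [mul_left_comm, mul_sub, single_mul_single, mul_one, mul_one, add_sub_cancel, mul_comm]
      have h2 : single (v + s) 1 * (1 - single (v' - v) 1) =
          (single (v + s) 1 - single (v' + s) 1 : AddMonoidAlgebra ℝ (Fin d → ℝ)) := by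
        rw [mul_sub, single_mul_single, mul_one, mul_one]
        congr 2
        abel
      change K * evalFunctional f ((single v 1 - single v' 1) * D) = _
      rw [h1, hs', h2, map_sub, evalFunctional_single, evalFunctional_single]
      ring
    have hK₂ : 0 ≤ K * ∏ i, h i ^ β i :=
      mul_nonneg hK₀ (Finset.prod_nonneg fun i _ => pow_nonneg (hh i).le _)
    rw [hφv, abs_mul, abs_of_nonneg hK₂]
    refine (mul_le_of_le_one_left (abs_nonneg _) hK₁).trans ?_
    simpa using hg _ (hmem v hv) _ (hmem v' hv')
  rw [hφ, hφ]
  refine ((Coupled.bernsteinProd (fun i => (hh i).le) hx hy).abs_sub_le hC hdiff).trans ?_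
  gcongr
  calc ∑ i, (((α - β) i : ℕ) : ℝ) * (h i * |x i - y i|) ≤ ∑ _i : Fin d, ‖x - y‖ := by
        refine Finset.sum_le_sum fun i _ => ?_
        rw [← mul_assoc]
        refine (mul_le_of_le_one_left (abs_nonneg _) ?_).trans (norm_le_pi_norm (x - y) i)
        have := mul_nonneg (Nat.cast_nonneg (α := ℝ) (β i)) (hh i).le
        linarith [hbox i]
    _ = d * ‖x - y‖ := by simp

end MixedPartial

/-- If all mixed partials `∂^γ f`, `γ ≤ β`, exist and are continuous, then the family
`(∂^β B_α(f))` indexed by the multiindices `α` with `α i > β i` for all `i`, restricted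
to `[0,1]^d`, is equicontinuous. -/
theorem mixedPartial_multiBernstein_equicontinuous (d : ℕ) (hd : 1 ≤ d) (β : Fin d → ℕ)
    (f : (Fin d → ℝ) → ℝ) (hf : HasContMixedPartials d β f) :
    Equicontinuous (fun (a : {α : Fin d → ℕ // ∀ i, β i < α i})
      (x : Set.Icc (0 : Fin d → ℝ) 1) => mixedPartial d β (multiBernstein d a.1 f) x) := by
  refine (Metric.uniformEquicontinuous_iff.2 fun ε hε => ?_).equicontinuous
  obtain ⟨C, hC, hg⟩ := (isCompact_Icc (a := (0 : Fin d → ℝ)) (b := 1)).exists_dist_le_add_mul_dist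
    (hf β le_rfl).1.continuousOn (half_pos hε)
  simp only [dist_eq_norm] at hg
  refine ⟨ε / 2 / (C * d + 1), by positivity, fun x y hxy a => ?_⟩
  rw [Subtype.dist_eq, dist_eq_norm, lt_div_iff₀ (by positivity)] at hxy
  have := hf.abs_sub_mixedPartial_multiBernstein_le a.2 hC hg x.2 y.2
  rw [Real.dist_eq]
  nlinarith [norm_nonneg ((x : Fin d → ℝ) - y)]
end

section
/- Let d ≥ 1, let β ∈ ℕ^d be a multiindex, and let f : ℝ^d → ℝ be such that all mixed partial derivatives ∂^γ f for γ ≤ β exist and are continuous. Then sup_{x ∈ [0,1]^d} | ∂^β B_α(f)(x) − ∂^β f(x) | → 0 as min_{1 ≤ j ≤ d} α_j → ∞; that is, for every ε > 0 there exists N such that for every α ∈ ℕ^d with all components α_j ≥ N, the supremum over [0,1]^d of |∂^β B_α(f) − ∂^β f| is less than ε. -/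
/-- The combination `∑ q ∈ S, w q • g(x with x_i replaced by t q)` of samples of `g` along the
`i`-th coordinate. -/
noncomputable def coordSample {d : ℕ} (i : Fin d) (S : Finset ℕ) (w t : ℕ → ℝ)
    (g : (Fin d → ℝ) → ℝ) : (Fin d → ℝ) → ℝ :=
  fun x => ∑ q ∈ S, w q * g (Function.update x i (t q))

/-- The composition of the operators `coordSample` over a list of coordinates. -/
noncomputable def iterSample {d : ℕ} (S : Fin d → Finset ℕ) (w t : Fin d → ℕ → ℝ)
    (l : List (Fin d)) (f : (Fin d → ℝ) → ℝ) : (Fin d → ℝ) → ℝ :=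
  l.foldr (fun i g => coordSample i (S i) (w i) (t i) g) f

lemma coordSample_comm {d : ℕ} {i j : Fin d} (hij : i ≠ j) (S S' : Finset ℕ)
    (w w' t t' : ℕ → ℝ) (g : (Fin d → ℝ) → ℝ) :
    coordSample i S w t (coordSample j S' w' t' g) =
      coordSample j S' w' t' (coordSample i S w t g) := by
  funext x
  simp only [coordSample, Finset.mul_sum]
  rw [Finset.sum_comm]
  refine Finset.sum_congr rfl fun q _ => Finset.sum_congr rfl fun r _ => ?_
  rw [Function.update_comm hij]
  ring

lemma iterSample_coordSample_comm {d : ℕ} (S : Fin d → Finset ℕ) (w t : Fin d → ℕ → ℝ)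
    {i : Fin d} (S' : Finset ℕ) (w' t' : ℕ → ℝ) (f : (Fin d → ℝ) → ℝ) (l : List (Fin d))
    (hi : i ∉ l) :
    iterSample S w t l (coordSample i S' w' t' f) =
      coordSample i S' w' t' (iterSample S w t l f) := by
  induction l with
  | nil => rfl
  | cons j l ih =>
    rw [List.mem_cons, not_or] at hi
    change coordSample j _ _ _ (iterSample S w t l _) = _
    rw [ih hi.2, coordSample_comm (Ne.symm hi.1)]
    rfl

lemma hasDerivAt_iterSample {d : ℕ} (S : Fin d → Finset ℕ) (w t : Fin d → ℕ → ℝ)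
    {i : Fin d} {f : (Fin d → ℝ) → ℝ}
    (hf : ∀ x, DifferentiableAt ℝ (fun s => f (Function.update x i s)) (x i))
    (l : List (Fin d)) (hi : i ∉ l) (x : Fin d → ℝ) (s : ℝ) :
    HasDerivAt (fun s => iterSample S w t l f (Function.update x i s))
      (iterSample S w t l (partialDeriv d i f) (Function.update x i s)) s := by
  induction l generalizing x with
  | nil =>
    have := (hf (Function.update x i s)).hasDerivAt
    simpa [iterSample, partialDeriv] using this
  | cons j l ih =>
    rw [List.mem_cons, not_or] at hi
    change HasDerivAt (fun s => ∑ q ∈ S j, w j q *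
        iterSample S w t l f (Function.update (Function.update x i s) j (t j q)))
      (∑ q ∈ S j, w j q * iterSample S w t l (partialDeriv d i f)
        (Function.update (Function.update x i s) j (t j q))) s
    refine HasDerivAt.fun_sum fun q _ => HasDerivAt.const_mul _ ?_
    simp only [Function.update_comm hi.1]
    exact ih hi.2 _

/-- Mean value theorem for tensor products of one-variable functionals: if each functional
`φ ↦ ∑ q ∈ S i, w i q * φ (t i q)` is always of the form `φ⁽ᵐ⁾(ξ)`, `ξ ∈ I i`, with `m = β i`, then
their product over the coordinates in `l` is an iterated partial derivative at some point. -/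
lemma exists_iterSample_eq {d : ℕ} (β : Fin d → ℕ) (S : Fin d → Finset ℕ)
    (w t : Fin d → ℕ → ℝ) (I : Fin d → Set ℝ)
    (H : ∀ i, ∀ φ : ℕ → ℝ → ℝ, (∀ k < β i, ∀ s, HasDerivAt (φ k) (φ (k + 1) s) s) →
      ∃ ξ ∈ I i, ∑ q ∈ S i, w i q * φ 0 (t i q) = φ (β i) ξ)
    (l : List (Fin d)) (hl : l.Nodup) (f : (Fin d → ℝ) → ℝ)
    (hf : ∀ l₁ i l₂, l = l₁ ++ i :: l₂ → ∀ k < β i, ∀ x, DifferentiableAt ℝ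
      (fun s => ((partialDeriv d i)^[k] (l₂.foldr (fun i g => (partialDeriv d i)^[β i] g) f))
        (Function.update x i s)) (x i)) (x : Fin d → ℝ) :
    ∃ ξ : Fin d → ℝ, (∀ i ∈ l, ξ i ∈ I i) ∧ (∀ i ∉ l, ξ i = x i) ∧
      iterSample S w t l f x = l.foldr (fun i g => (partialDeriv d i)^[β i] g) f ξ := by
  induction l using List.reverseRecOn generalizing f x with
  | nil => exact ⟨x, by simp, by simp, rfl⟩
  | append_singleton l i ih =>
    have hi : i ∉ l := by
      have := List.nodup_append.1 hl
      intro h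
      exact this.2.2 i h i (by simp) rfl
    have hl' : l.Nodup := (List.nodup_append.1 hl).1
    obtain ⟨s, hs, hse⟩ := H i
      (fun k s => iterSample S w t l ((partialDeriv d i)^[k] f) (Function.update x i s))
      (fun k hk s => by
        have := hasDerivAt_iterSample S w t (f := (partialDeriv d i)^[k] f)
          (hf l i [] rfl k hk) l hi x s
        rwa [← Function.iterate_succ_apply' (partialDeriv d i)] at this)
    obtain ⟨ξ, h1, h2, h3⟩ := ih hl' ((partialDeriv d i)^[β i] f)
      (fun l₁ j l₂ h k hk y => by
        have := hf l₁ j (l₂ ++ [i]) (by simp [h]) k hk y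
        simpa [List.foldr_append] using this) (Function.update x i s)
    refine ⟨ξ, ?_, ?_, ?_⟩
    · intro j hj
      rw [List.mem_append, List.mem_singleton] at hj
      rcases hj with hj | rfl
      · exact h1 j hj
      · rw [h2 j hi, Function.update_self]; exact hs
    · intro j hj
      rw [List.mem_append, List.mem_singleton, not_or] at hj
      rw [h2 j hj.1, Function.update_of_ne hj.2]
    · rw [List.foldr_append]
      change _ = l.foldr _ ((partialDeriv d i)^[β i] f) ξ
      rw [← h3, ← hse]
      change (l ++ [i]).foldr _ f x = _
      rw [List.foldr_append]
      change iterSample S w t l (coordSample i _ _ _ f) x = _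
      rw [iterSample_coordSample_comm _ _ _ _ _ _ _ _ hi]
      rfl

/-- The composition of the sampling operators as a sum over a box of indices. -/
lemma iterSample_eq_sum {d : ℕ} (S : Fin d → Finset ℕ) (w t : Fin d → ℕ → ℝ)
    (f : (Fin d → ℝ) → ℝ) (l : List (Fin d)) (hl : l.Nodup) (x : Fin d → ℝ) :
    iterSample S w t l f x =
      ∑ k ∈ Fintype.piFinset (fun i => if i ∈ l then S i else {0}),
        (∏ i ∈ l.toFinset, w i (k i)) * f (fun i => if i ∈ l then t i (k i) else x i) := by
  induction l generalizing x with
  | nil =>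
    have : (Fintype.piFinset fun _ : Fin d => ({0} : Finset ℕ)) = {0} := by
      ext k; simp [funext_iff]
    simp [iterSample, this]
  | cons i l ih =>
    obtain ⟨hi, hl⟩ := List.nodup_cons.1 hl
    change ∑ q ∈ S i, w i q * iterSample S w t l f (Function.update x i (t i q)) = _
    simp only [ih hl, Finset.mul_sum]
    rw [← Finset.sum_product']
    refine Finset.sum_nbij' (fun p => Function.update p.2 i p.1)
      (fun k => (k i, Function.update k i 0)) ?_ ?_ ?_ ?_ ?_
    · rintro ⟨q, k⟩ h
      simp only [Finset.mem_product, Fintype.mem_piFinset] at h ⊢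
      intro j
      rcases eq_or_ne j i with rfl | hj
      · simpa using h.1
      · simpa [hj] using h.2 j
    · intro k h
      simp only [Finset.mem_product, Fintype.mem_piFinset] at h ⊢
      refine ⟨by simpa using h i, fun j => ?_⟩
      rcases eq_or_ne j i with rfl | hj
      · simp [hi]
      · simpa [hj] using h j
    · rintro ⟨q, k⟩ h
      simp only [Finset.mem_product, Fintype.mem_piFinset] at h
      have : k i = 0 := by simpa [hi] using h.2 i
      simp [← this]
    · intro k _
      simp
    · rintro ⟨q, k⟩ h
      have hi' : i ∉ l.toFinset := by simpa using hi
      rw [List.toFinset_cons, Finset.prod_insert hi', Function.update_self, mul_assoc]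
      congr 2
      · refine Finset.prod_congr rfl fun j hj => ?_
        rw [Function.update_of_ne (by rintro rfl; exact hi' hj)]
      · congr 1
        funext j
        rcases eq_or_ne j i with rfl | hj
        · simp [hi]
        · simp [hj]

/-- Mean value theorem for iterated forward differences. -/
lemma exists_fwdDiff_iter_eq {h : ℝ} (hh : 0 < h) (m : ℕ) (φ : ℕ → ℝ → ℝ)
    (hφ : ∀ k < m, ∀ s, HasDerivAt (φ k) (φ (k + 1) s) s) (y : ℝ) :
    ∃ ξ ∈ Set.Icc y (y + m * h), (fwdDiff h)^[m] (φ 0) y = h ^ m * φ m ξ := by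
  induction m generalizing φ with
  | zero => exact ⟨y, by simp, by simp⟩
  | succ m ih =>
    obtain ⟨ξ, hξ, hξe⟩ := ih (fun k => fwdDiff h (φ k)) (fun k hk s => by
      have h1 := hφ k (by omega)
      exact ((h1 (s + h)).comp_add_const s h).sub (h1 s))
    obtain ⟨η, hη, hηe⟩ := exists_hasDerivAt_eq_slope (φ m) (φ (m + 1))
      (show ξ < ξ + h by linarith)
      (fun s _ => (hφ m (by omega) s).continuousAt.continuousWithinAt)
      (fun s _ => hφ m (by omega) s)
    refine ⟨η, ⟨by linarith [hξ.1, hη.1], ?_⟩, ?_⟩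
    · push_cast
      linarith [hξ.2, hη.2]
    · rw [Function.iterate_succ_apply, hξe, hηe, fwdDiff, add_sub_cancel_left]
      field_simp
      ring

open Polynomial in
lemma partialDeriv_sum_prod_eval {d : ℕ} {κ : Type*} (s : Finset κ) (c : κ → ℝ)
    (p : κ → Fin d → ℝ[X]) (i : Fin d) :
    partialDeriv d i (fun x => ∑ k ∈ s, c k * ∏ j, (p k j).eval (x j)) =
      fun x => ∑ k ∈ s, c k *
        ∏ j, (Function.update (p k) i (derivative (p k i)) j).eval (x j) := by
  funext x
  refine HasDerivAt.deriv (HasDerivAt.fun_sum fun k _ => HasDerivAt.const_mul _ ?_)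
  have h1 : ∀ t, ∏ j, (p k j).eval (Function.update x i t j) =
      (p k i).eval t * ∏ j ∈ Finset.univ.erase i, (p k j).eval (x j) := fun t => by
    rw [← Finset.mul_prod_erase _ _ (Finset.mem_univ i), Function.update_self]
    congr 1
    refine Finset.prod_congr rfl fun j hj => ?_
    rw [Function.update_of_ne (Finset.ne_of_mem_erase hj)]
  have h2 : ∏ j, (Function.update (p k) i (derivative (p k i)) j).eval (x j) =
      (derivative (p k i)).eval (x i) * ∏ j ∈ Finset.univ.erase i, (p k j).eval (x j) := by
    rw [← Finset.mul_prod_erase _ _ (Finset.mem_univ i), Function.update_self]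
    congr 1
    refine Finset.prod_congr rfl fun j hj => ?_
    rw [Function.update_of_ne (Finset.ne_of_mem_erase hj)]
  simp only [h1, h2]
  exact ((p k i).hasDerivAt (x i)).mul_const _

open Polynomial in
lemma iterate_partialDeriv_sum_prod_eval {d : ℕ} {κ : Type*} (s : Finset κ) (c : κ → ℝ)
    (p : κ → Fin d → ℝ[X]) (i : Fin d) (m : ℕ) :
    (partialDeriv d i)^[m] (fun x => ∑ k ∈ s, c k * ∏ j, (p k j).eval (x j)) =
      fun x => ∑ k ∈ s, c k *
        ∏ j, (Function.update (p k) i (derivative^[m] (p k i)) j).eval (x j) := by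
  induction m with
  | zero => simp
  | succ m ih =>
    rw [Function.iterate_succ_apply', ih, partialDeriv_sum_prod_eval]
    simp only [Function.update_self, Function.update_idem, ← Function.iterate_succ_apply']

open Polynomial in
lemma mixedPartial_sum_prod_eval {d : ℕ} {κ : Type*} (s : Finset κ) (c : κ → ℝ)
    (p : κ → Fin d → ℝ[X]) (β : Fin d → ℕ) :
    mixedPartial d β (fun x => ∑ k ∈ s, c k * ∏ j, (p k j).eval (x j)) =
      fun x => ∑ k ∈ s, c k * ∏ j, (derivative^[β j] (p k j)).eval (x j) := by
  have key : ∀ l : List (Fin d), l.Nodup →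
      l.foldr (fun i g => (partialDeriv d i)^[β i] g)
        (fun x => ∑ k ∈ s, c k * ∏ j, (p k j).eval (x j)) =
      fun x => ∑ k ∈ s, c k *
        ∏ j, (if j ∈ l then derivative^[β j] (p k j) else p k j).eval (x j) := by
    intro l hl
    induction l with
    | nil => simp
    | cons i l ih =>
      obtain ⟨hi, hl⟩ := List.nodup_cons.1 hl
      rw [List.foldr_cons, ih hl, iterate_partialDeriv_sum_prod_eval s c
        (fun k j => if j ∈ l then derivative^[β j] (p k j) else p k j)]
      funext x
      refine Finset.sum_congr rfl fun k _ => ?_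
      congr 1
      refine Finset.prod_congr rfl fun j _ => ?_
      rcases eq_or_ne j i with rfl | hj
      · simp [hi]
      · simp [hj]
  rw [mixedPartial, key _ (List.nodup_finRange d)]
  simp

lemma multiBernstein_eq_sum {d : ℕ} (α : Fin d → ℕ) (f : (Fin d → ℝ) → ℝ) :
    multiBernstein d α f = fun x =>
      ∑ k ∈ Fintype.piFinset (fun i => Finset.range (α i + 1)),
        f (fun i => (k i : ℝ) / α i) * ∏ i, (bernsteinPolynomial ℝ (α i) (k i)).eval (x i) := by
  funext x
  rw [multiBernstein]
  refine Finset.sum_bij' (fun k _ i => (k i : ℕ))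
    (fun k hk i => ⟨k i, by simpa using Fintype.mem_piFinset.1 hk i⟩) ?_ ?_ ?_ ?_ ?_
  · intro k _
    simp only [Fintype.mem_piFinset, Finset.mem_range]
    exact fun i => (k i).2
  · simp
  · simp
  · simp
  · intro k _
    simp only [bernsteinPolynomial, Polynomial.eval_mul, Polynomial.eval_pow,
      Polynomial.eval_sub, Polynomial.eval_natCast, Polynomial.eval_X, Polynomial.eval_one,
      mul_assoc, Finset.prod_mul_distrib]
    ring

/-- The coefficient of `φ k` in the `m`-th forward difference of `φ` at `j`. -/
noncomputable def diffCoeff (m j k : ℕ) : ℝ :=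
  (fwdDiff 1)^[m] (fun r : ℕ => if r = k then (1 : ℝ) else 0) j

lemma diffCoeff_succ_zero (m j : ℕ) : diffCoeff (m + 1) j 0 = -diffCoeff m j 0 := by
  have : fwdDiff 1 (fun r : ℕ => if r = 0 then (1 : ℝ) else 0) =
      (-1 : ℝ) • fun r : ℕ => if r = 0 then (1 : ℝ) else 0 := by
    funext r; by_cases hr : r = 0 <;> simp [fwdDiff, hr]
  rw [diffCoeff, Function.iterate_succ_apply, this, fwdDiff_iter_const_smul]
  simp [diffCoeff]

lemma diffCoeff_succ_succ (m j k : ℕ) :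
    diffCoeff (m + 1) j (k + 1) = diffCoeff m j k - diffCoeff m j (k + 1) := by
  have : fwdDiff 1 (fun r : ℕ => if r = k + 1 then (1 : ℝ) else 0) =
      (fun r : ℕ => if r = k then (1 : ℝ) else 0) +
        (-1 : ℝ) • fun r : ℕ => if r = k + 1 then (1 : ℝ) else 0 := by
    funext r; simp [fwdDiff, sub_eq_add_neg]
  rw [diffCoeff, Function.iterate_succ_apply, this, fwdDiff_iter_add, fwdDiff_iter_const_smul]
  simp [diffCoeff, sub_eq_add_neg]

lemma sum_diffCoeff_mul {m j n : ℕ} (h : j + m ≤ n) (φ : ℕ → ℝ) :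
    ∑ k ∈ Finset.range (n + 1), diffCoeff m j k * φ k = (fwdDiff 1)^[m] φ j := by
  simp only [diffCoeff, fwdDiff_iter_eq_sum_shift, Finset.sum_mul]
  rw [Finset.sum_comm]
  refine Finset.sum_congr rfl fun l hl => ?_
  rw [Finset.mem_range] at hl
  rw [Finset.sum_eq_single (j + l • 1)]
  · simp
  · intro k _ hk
    rw [if_neg (Ne.symm hk)]
    simp
  · intro hk
    simp at hk
    omega

open Polynomial in
lemma iterate_derivative_bernsteinPolynomial (m : ℕ) {n : ℕ} (h : m ≤ n) (k : ℕ) :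
    derivative^[m] (bernsteinPolynomial ℝ n k) =
      C (n.descFactorial m : ℝ) * ∑ j ∈ Finset.range (n - m + 1),
        C (diffCoeff m j k) * bernsteinPolynomial ℝ (n - m) j := by
  induction m generalizing n k with
  | zero =>
    rcases le_or_gt k n with hk | hk
    · simp [diffCoeff, Nat.lt_succ_of_le hk]
    · simp [diffCoeff, bernsteinPolynomial.eq_zero_of_lt ℝ hk]
  | succ m ih =>
    obtain ⟨n, rfl⟩ : ∃ n', n = n' + 1 := ⟨n - 1, by omega⟩
    have hm : m ≤ n := by omega
    have hC : ∀ p : ℝ[X], derivative^[m] (((n + 1 : ℕ) : ℝ[X]) * p) =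
        C ((n + 1 : ℕ) : ℝ) * derivative^[m] p := fun p => by
      rw [← iterate_derivative_C_mul, C_eq_natCast]
    rw [Function.iterate_succ_apply, Nat.succ_descFactorial_succ, Nat.add_sub_add_right]
    cases k with
    | zero =>
      rw [bernsteinPolynomial.derivative_zero, neg_mul, iterate_derivative_neg, hC,
        Nat.add_sub_cancel, ih hm]
      simp only [diffCoeff_succ_zero, C_neg, neg_mul, Finset.sum_neg_distrib, Nat.cast_mul, C_mul]
      ring
    | succ k =>
      rw [bernsteinPolynomial.derivative_succ, hC, iterate_derivative_sub,
        Nat.add_sub_cancel, ih hm, ih hm]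
      simp only [diffCoeff_succ_succ, C_sub, sub_mul, Finset.sum_sub_distrib, Nat.cast_mul, C_mul]
      ring

/-- Mean value theorem for the normalised `m`-th difference with step `1 / n`. -/
lemma exists_sum_diffCoeff_eq {m j n : ℕ} (hn : 0 < n) (h : j + m ≤ n) (φ : ℕ → ℝ → ℝ)
    (hφ : ∀ k < m, ∀ s, HasDerivAt (φ k) (φ (k + 1) s) s) :
    ∃ ξ ∈ Set.Icc ((j : ℝ) / n) ((j + m : ℝ) / n),
      ∑ k ∈ Finset.range (n + 1), (n : ℝ) ^ m * diffCoeff m j k * φ 0 ((k : ℝ) / n) = φ m ξ := by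
  have hn' : (0 : ℝ) < n := by exact_mod_cast hn
  obtain ⟨ξ, hξ, hξe⟩ := exists_fwdDiff_iter_eq (one_div_pos.2 hn') m φ hφ ((j : ℝ) / n)
  refine ⟨ξ, ⟨hξ.1, hξ.2.trans_eq (by ring)⟩, ?_⟩
  have hstep : (fwdDiff 1)^[m] (fun k : ℕ => φ 0 ((k : ℝ) / n)) j =
      (fwdDiff (1 / (n : ℝ)))^[m] (φ 0) ((j : ℝ) / n) := by
    simp only [fwdDiff_iter_eq_sum_shift]
    refine Finset.sum_congr rfl fun l _ => ?_
    congr 2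
    simp
    ring
  simp only [mul_assoc]
  rw [← Finset.mul_sum, sum_diffCoeff_mul h (fun k : ℕ => φ 0 ((k : ℝ) / n)), hstep, hξe,
    ← mul_assoc, ← mul_pow, mul_one_div_cancel hn'.ne', one_pow, one_mul]

lemma HasContMixedPartials.differentiableAt_foldr {d : ℕ} {β : Fin d → ℕ}
    {f : (Fin d → ℝ) → ℝ} (hf : HasContMixedPartials d β f) {l₁ l₂ : List (Fin d)} {i : Fin d}
    (hl : List.finRange d = l₁ ++ i :: l₂) {k : ℕ} (hk : k < β i) (x : Fin d → ℝ) :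
    DifferentiableAt ℝ (fun s => ((partialDeriv d i)^[k]
      (l₂.foldr (fun i g => (partialDeriv d i)^[β i] g) f)) (Function.update x i s)) (x i) := by
  classical
  have hnd : (l₁ ++ i :: l₂).Nodup := hl ▸ List.nodup_finRange d
  obtain ⟨-, h2, h3⟩ := List.nodup_append.1 hnd
  have hi : i ∉ l₂ := (List.nodup_cons.1 h2).1
  set γ : Fin d → ℕ := fun j => if j ∈ l₂ then β j else if j = i then k else 0 with hγ
  have hγi : γ i = k := by simp [hγ, hi]
  have hγβ : γ ≤ β := fun j => by
    simp only [hγ]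
    split_ifs with h h'
    · exact le_rfl
    · exact h' ▸ hk.le
    · exact Nat.zero_le _
  have hm : mixedPartial d γ f = (partialDeriv d i)^[k]
      (l₂.foldr (fun i g => (partialDeriv d i)^[β i] g) f) := by
    have e₂ : l₂.foldr (fun i g => (partialDeriv d i)^[γ i] g) f =
        l₂.foldr (fun i g => (partialDeriv d i)^[β i] g) f :=
      List.foldr_ext _ _ _ fun j hj g => by simp [hγ, hj]
    have e₁ : ∀ F, l₁.foldr (fun i g => (partialDeriv d i)^[γ i] g) F = F := fun F => by
      rw [List.foldr_ext _ (fun _ g => g) _ fun j hj g => ?_]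
      · clear hl hnd h3
        induction l₁ <;> simp_all
      · have hj₁ : j ≠ i := h3 j hj i (by simp)
        have hj₂ : j ∉ l₂ := fun h => h3 j hj j (by simp [h]) rfl
        simp [hγ, hj₁, hj₂]
    rw [mixedPartial, hl, List.foldr_append, List.foldr_cons, e₁, e₂, hγi]
  rw [← hm]
  exact (hf γ hγβ).2 i (hγi ▸ hk) x

/-- The mixed partial derivative of a Bernstein polynomial of `f` is a rescaled Bernstein-type
average of values of the mixed partial derivative of `f` near the nodes. -/
lemma exists_mixedPartial_multiBernstein_eq {d : ℕ} {β : Fin d → ℕ} {f : (Fin d → ℝ) → ℝ}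
    (hf : HasContMixedPartials d β f) {α : Fin d → ℕ} (hα : ∀ i, 0 < α i) (hβα : β ≤ α) :
    ∃ ξ : (Fin d → ℕ) → Fin d → ℝ,
      (∀ j ∈ Fintype.piFinset (fun i => Finset.range (α i - β i + 1)), ∀ i,
        ξ j i ∈ Set.Icc ((j i : ℝ) / α i) ((j i + β i : ℝ) / α i)) ∧
      ∀ x, mixedPartial d β (multiBernstein d α f) x =
        (∏ i, ((α i).descFactorial (β i) : ℝ) / (α i : ℝ) ^ β i) *
        ∑ j ∈ Fintype.piFinset (fun i => Finset.range (α i - β i + 1)),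
          (∏ i, (bernsteinPolynomial ℝ (α i - β i) (j i)).eval (x i)) *
            mixedPartial d β f (ξ j) := by
  have hαr : ∀ i, (α i : ℝ) ≠ 0 := fun i => by exact_mod_cast (hα i).ne'
  have key : ∀ j : Fin d → ℕ, ∃ ξ : Fin d → ℝ,
      j ∈ Fintype.piFinset (fun i => Finset.range (α i - β i + 1)) →
      (∀ i, ξ i ∈ Set.Icc ((j i : ℝ) / α i) ((j i + β i : ℝ) / α i)) ∧
      ∑ k ∈ Fintype.piFinset (fun i => Finset.range (α i + 1)),
        f (fun i => (k i : ℝ) / α i) * ∏ i, diffCoeff (β i) (j i) (k i) =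
        (∏ i, ((α i : ℝ) ^ β i)⁻¹) * mixedPartial d β f ξ := by
    intro j
    by_cases hj : j ∈ Fintype.piFinset (fun i => Finset.range (α i - β i + 1))
    swap
    · exact ⟨0, fun h => absurd h hj⟩
    obtain ⟨ξ, h1, -, h3⟩ := exists_iterSample_eq β (fun i => Finset.range (α i + 1))
      (fun i k => (α i : ℝ) ^ β i * diffCoeff (β i) (j i) k) (fun i k => (k : ℝ) / α i)
      (fun i => Set.Icc ((j i : ℝ) / α i) ((j i + β i : ℝ) / α i))
      (fun i φ hφ => exists_sum_diffCoeff_eq (hα i) (by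
        have h1 := Finset.mem_range.1 (Fintype.mem_piFinset.1 hj i)
        have h2 : β i ≤ α i := hβα i
        omega) φ hφ)
      (List.finRange d) (List.nodup_finRange d) f
      (fun _ _ _ hl _ hk x => hf.differentiableAt_foldr hl hk x) 0
    refine ⟨ξ, fun _ => ⟨fun i => h1 i (List.mem_finRange i), ?_⟩⟩
    rw [iterSample_eq_sum _ _ _ _ _ (List.nodup_finRange d)] at h3
    change _ = mixedPartial d β f ξ at h3
    rw [← h3, Finset.mul_sum]
    simp only [List.mem_finRange, if_true, List.toFinset_finRange, Finset.prod_mul_distrib]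
    refine Finset.sum_congr rfl fun k _ => ?_
    rw [← mul_assoc, ← mul_assoc, ← Finset.prod_mul_distrib]
    simp [hαr, mul_comm]
  choose ξ hξ using key
  refine ⟨ξ, fun j hj => (hξ j hj).1, fun x => ?_⟩
  rw [multiBernstein_eq_sum, mixedPartial_sum_prod_eval]
  simp only [iterate_derivative_bernsteinPolynomial _ (hβα _), Polynomial.eval_mul,
    Polynomial.eval_finsetSum, Polynomial.eval_C, Finset.prod_mul_distrib,
    Finset.prod_univ_sum, Finset.mul_sum]
  rw [Finset.sum_comm]
  refine Finset.sum_congr rfl fun j hj => ?_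
  have h := (hξ j hj).2
  simp only [div_eq_mul_inv, Finset.prod_mul_distrib] at h ⊢
  calc _ = (∏ i, ((α i).descFactorial (β i) : ℝ)) *
      (∏ i, (bernsteinPolynomial ℝ (α i - β i) (j i)).eval (x i)) *
      ∑ k ∈ Fintype.piFinset (fun i => Finset.range (α i + 1)),
        f (fun i => (k i : ℝ) * (α i : ℝ)⁻¹) * ∏ i, diffCoeff (β i) (j i) (k i) := by
        rw [Finset.mul_sum]
        refine Finset.sum_congr rfl fun k _ => ?_
        ring
    _ = _ := by rw [h]; ring

/-- The weight of the multiindex `j` in the multivariate Bernstein polynomial of degree `n`. -/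
noncomputable def bernsteinWeight {d : ℕ} (n j : Fin d → ℕ) (x : Fin d → ℝ) : ℝ :=
  ∏ i, (bernsteinPolynomial ℝ (n i) (j i)).eval (x i)

lemma eval_bernsteinPolynomial_nonneg (n k : ℕ) {t : ℝ} (ht : t ∈ Set.Icc (0 : ℝ) 1) :
    0 ≤ (bernsteinPolynomial ℝ n k).eval t := by
  have h0 := ht.1
  have h1 : 0 ≤ 1 - t := sub_nonneg.2 ht.2
  simp only [bernsteinPolynomial, Polynomial.eval_mul, Polynomial.eval_pow,
    Polynomial.eval_sub, Polynomial.eval_natCast, Polynomial.eval_X, Polynomial.eval_one]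
  positivity

lemma sum_eval_bernsteinPolynomial (n : ℕ) (t : ℝ) :
    ∑ k ∈ Finset.range (n + 1), (bernsteinPolynomial ℝ n k).eval t = 1 := by
  rw [← Polynomial.eval_finsetSum, bernsteinPolynomial.sum, Polynomial.eval_one]

lemma sum_eval_bernsteinPolynomial_mul_sq {n : ℕ} (hn : 0 < n) (t : ℝ) :
    ∑ k ∈ Finset.range (n + 1), (bernsteinPolynomial ℝ n k).eval t * ((k : ℝ) / n - t) ^ 2 =
      t * (1 - t) / n := by
  have hn' : (n : ℝ) ≠ 0 := by exact_mod_cast hn.ne'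
  have h := congrArg (Polynomial.eval t) (bernsteinPolynomial.variance ℝ n)
  simp only [Polynomial.eval_finsetSum, Polynomial.eval_mul, Polynomial.eval_pow,
    Polynomial.eval_sub, Polynomial.eval_natCast, Polynomial.eval_X, Polynomial.eval_one,
    nsmul_eq_mul] at h
  have h2 : t * (1 - t) / n = (n * t * (1 - t)) / (n : ℝ) ^ 2 := by field_simp
  rw [h2, ← h, Finset.sum_div]
  refine Finset.sum_congr rfl fun k _ => ?_
  field_simp
  ring

lemma bernsteinWeight_nonneg {d : ℕ} (n j : Fin d → ℕ) {x : Fin d → ℝ}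
    (hx : x ∈ Set.Icc (0 : Fin d → ℝ) 1) : 0 ≤ bernsteinWeight n j x :=
  Finset.prod_nonneg fun i _ => eval_bernsteinPolynomial_nonneg _ _ ⟨hx.1 i, hx.2 i⟩

lemma sum_bernsteinWeight {d : ℕ} (n : Fin d → ℕ) (x : Fin d → ℝ) :
    ∑ j ∈ Fintype.piFinset (fun i => Finset.range (n i + 1)), bernsteinWeight n j x = 1 := by
  simp only [bernsteinWeight]
  rw [← Finset.prod_univ_sum (fun i => Finset.range (n i + 1))
    (fun i k => (bernsteinPolynomial ℝ (n i) k).eval (x i))]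
  simp [sum_eval_bernsteinPolynomial]

lemma sum_bernsteinWeight_mul {d : ℕ} (n : Fin d → ℕ) (x : Fin d → ℝ) (i : Fin d)
    (φ : ℕ → ℝ) :
    ∑ j ∈ Fintype.piFinset (fun i => Finset.range (n i + 1)), bernsteinWeight n j x * φ (j i) =
      ∑ k ∈ Finset.range (n i + 1), (bernsteinPolynomial ℝ (n i) k).eval (x i) * φ k := by
  have h := Finset.prod_univ_sum (fun i => Finset.range (n i + 1))
    (fun a k => (bernsteinPolynomial ℝ (n a) k).eval (x a) * if a = i then φ k else 1)
  simp only [Finset.prod_mul_distrib, Finset.prod_ite_eq', Finset.mem_univ, if_true] at h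
  simp only [bernsteinWeight]
  rw [← h, ← Finset.mul_prod_erase _ _ (Finset.mem_univ i), Finset.prod_eq_one, mul_one]
  · simp
  · intro a ha
    simp [Finset.ne_of_mem_erase ha, sum_eval_bernsteinPolynomial]

lemma sum_bernsteinWeight_mul_sq_le {d : ℕ} {n : Fin d → ℕ} {x : Fin d → ℝ}
    (hx : x ∈ Set.Icc (0 : Fin d → ℝ) 1) (i : Fin d) (hn : 0 < n i) :
    ∑ j ∈ Fintype.piFinset (fun i => Finset.range (n i + 1)),
      bernsteinWeight n j x * ((j i : ℝ) / n i - x i) ^ 2 ≤ 1 / n i := by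
  rw [sum_bernsteinWeight_mul n x i fun k => ((k : ℝ) / n i - x i) ^ 2,
    sum_eval_bernsteinPolynomial_mul_sq hn]
  have h0 : 0 ≤ x i := hx.1 i
  have h1 : x i ≤ 1 := hx.2 i
  gcongr
  nlinarith

/-- If `g` has oscillation at most `ε` at scale `δ` on the unit cube, then the averages of
`g (ξ j)` with Bernstein weights are close to `g x` whenever `ξ j` is close to the node `j / n`. -/
lemma abs_sum_bernsteinWeight_sub_le {d : ℕ} {g : (Fin d → ℝ) → ℝ} {M ε δ : ℝ} (hε : 0 ≤ ε)
    (hδ : 0 < δ) (hM : ∀ y ∈ Set.Icc (0 : Fin d → ℝ) 1, |g y| ≤ M)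
    (hg : ∀ y ∈ Set.Icc (0 : Fin d → ℝ) 1, ∀ z ∈ Set.Icc (0 : Fin d → ℝ) 1,
      dist y z < δ → |g y - g z| ≤ ε)
    {n : Fin d → ℕ} (hn : ∀ i, 0 < n i) {r : Fin d → ℝ} {ξ : (Fin d → ℕ) → Fin d → ℝ}
    (hξ : ∀ j ∈ Fintype.piFinset (fun i => Finset.range (n i + 1)),
      ξ j ∈ Set.Icc (0 : Fin d → ℝ) 1 ∧ ∀ i, |ξ j i - (j i : ℝ) / n i| ≤ r i)
    {x : Fin d → ℝ} (hx : x ∈ Set.Icc (0 : Fin d → ℝ) 1) :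
    |∑ j ∈ Fintype.piFinset (fun i => Finset.range (n i + 1)),
        bernsteinWeight n j x * g (ξ j) - g x| ≤
      ε + 4 * M / δ ^ 2 * ∑ i, (r i ^ 2 + 1 / n i) := by
  have hM0 : 0 ≤ M := (abs_nonneg _).trans (hM x hx)
  set B := Fintype.piFinset (fun i => Finset.range (n i + 1)) with hB
  have hpt : ∀ j ∈ B, |g (ξ j) - g x| ≤
      ε + 4 * M / δ ^ 2 * ∑ i, (r i ^ 2 + ((j i : ℝ) / n i - x i) ^ 2) := fun j hj => by
    obtain ⟨hcube, hr⟩ := hξ j hj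
    have hnn : ∀ i, 0 ≤ r i ^ 2 + ((j i : ℝ) / n i - x i) ^ 2 := fun i => by positivity
    rcases lt_or_ge (dist (ξ j) x) δ with h | h
    · have h1 := hg _ hcube _ hx h
      have h2 : 0 ≤ 4 * M / δ ^ 2 * ∑ i, (r i ^ 2 + ((j i : ℝ) / n i - x i) ^ 2) :=
        mul_nonneg (by positivity) (Finset.sum_nonneg fun i _ => hnn i)
      linarith
    · have hne : ∃ i, δ ≤ dist (ξ j i) (x i) := by
        by_contra! hcon
        exact absurd h (not_le.2 ((dist_pi_lt_iff hδ).2 hcon))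
      obtain ⟨i, hi⟩ := hne
      rw [Real.dist_eq] at hi
      have h1 : δ ^ 2 ≤ (ξ j i - x i) ^ 2 := by
        rw [← sq_abs (ξ j i - x i)]; gcongr
      have h2 : (ξ j i - (j i : ℝ) / n i) ^ 2 ≤ r i ^ 2 := by
        rw [← sq_abs]; have := hr i; gcongr
      have h3 : δ ^ 2 ≤ 2 * (r i ^ 2 + ((j i : ℝ) / n i - x i) ^ 2) := by
        nlinarith [sq_nonneg ((ξ j i - (j i : ℝ) / n i) - ((j i : ℝ) / n i - x i))]
      have h4 : r i ^ 2 + ((j i : ℝ) / n i - x i) ^ 2 ≤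
          ∑ i, (r i ^ 2 + ((j i : ℝ) / n i - x i) ^ 2) :=
        Finset.single_le_sum (f := fun i => r i ^ 2 + ((j i : ℝ) / n i - x i) ^ 2)
          (fun i _ => hnn i) (Finset.mem_univ i)
      have h5 : |g (ξ j) - g x| ≤ 2 * M := by
        have := abs_sub (g (ξ j)) (g x)
        linarith [hM _ hcube, hM _ hx]
      have h6 : 2 * M = 4 * M / δ ^ 2 * (δ ^ 2 / 2) := by field_simp; ring
      have h7 : 4 * M / δ ^ 2 * (δ ^ 2 / 2) ≤
          4 * M / δ ^ 2 * ∑ i, (r i ^ 2 + ((j i : ℝ) / n i - x i) ^ 2) := by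
        gcongr
        linarith
      linarith
  have hsum : ∑ j ∈ B, bernsteinWeight n j x = 1 := sum_bernsteinWeight n x
  calc |∑ j ∈ B, bernsteinWeight n j x * g (ξ j) - g x|
      = |∑ j ∈ B, bernsteinWeight n j x * (g (ξ j) - g x)| := by
        simp only [mul_sub, Finset.sum_sub_distrib, ← Finset.sum_mul, hsum, one_mul]
    _ ≤ ∑ j ∈ B, bernsteinWeight n j x * |g (ξ j) - g x| := by
        refine (Finset.abs_sum_le_sum_abs _ _).trans_eq (Finset.sum_congr rfl fun j _ => ?_)
        rw [abs_mul, abs_of_nonneg (bernsteinWeight_nonneg n j hx)]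
    _ ≤ ∑ j ∈ B, bernsteinWeight n j x *
          (ε + 4 * M / δ ^ 2 * ∑ i, (r i ^ 2 + ((j i : ℝ) / n i - x i) ^ 2)) :=
        Finset.sum_le_sum fun j hj =>
          mul_le_mul_of_nonneg_left (hpt j hj) (bernsteinWeight_nonneg n j hx)
    _ = ε + 4 * M / δ ^ 2 * ∑ i, (r i ^ 2 +
          ∑ j ∈ B, bernsteinWeight n j x * ((j i : ℝ) / n i - x i) ^ 2) := by
        simp only [mul_add, Finset.sum_add_distrib, ← Finset.sum_mul, hsum, one_mul]
        congr 2
        simp only [mul_left_comm _ (4 * M / δ ^ 2), ← Finset.mul_sum]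
        congr 1
        simp only [Finset.mul_sum]
        exact Finset.sum_comm
    _ ≤ _ := by
        gcongr with i
        exact sum_bernsteinWeight_mul_sq_le hx i (hn i)

open Filter Topology in
lemma tendsto_descFactorial_div_pow (m : ℕ) :
    Tendsto (fun n : ℕ => (n.descFactorial m : ℝ) / (n : ℝ) ^ m) atTop (𝓝 1) := by
  induction m with
  | zero => simp
  | succ m ih =>
    have h : Tendsto (fun n : ℕ => 1 - (m : ℝ) / n) atTop (𝓝 1) := by
      simpa using (tendsto_const_div_atTop_nhds_zero_nat (m : ℝ)).const_sub 1
    have := h.mul ih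
    rw [one_mul] at this
    refine this.congr' ?_
    filter_upwards [eventually_ge_atTop (m + 1)] with n hn
    have hn0 : (n : ℝ) ≠ 0 := by
      have : n ≠ 0 := by omega
      exact_mod_cast this
    rw [Nat.descFactorial_succ, Nat.cast_mul, Nat.cast_sub (by omega)]
    field_simp
    ring

lemma mem_Icc_and_abs_sub_div_le {j b a : ℕ} (hb : b < a) (hj : j ≤ a - b) {ξ : ℝ}
    (hξ : ξ ∈ Set.Icc ((j : ℝ) / a) ((j + b : ℝ) / a)) :
    ξ ∈ Set.Icc (0 : ℝ) 1 ∧ |ξ - (j : ℝ) / (a - b : ℕ)| ≤ (b : ℝ) / a := by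
  have ha : (0 : ℝ) < a := by exact_mod_cast (Nat.zero_le b).trans_lt hb
  have hab : (0 : ℝ) < a - b := by rw [sub_pos]; exact_mod_cast hb
  have hj' : (j : ℝ) ≤ a - b := by
    rw [← Nat.cast_sub hb.le]; exact_mod_cast hj
  have hb0 : (0 : ℝ) ≤ b := Nat.cast_nonneg b
  have hj0 : (0 : ℝ) ≤ j := Nat.cast_nonneg j
  have h1 : (j : ℝ) / a ≤ j / (a - b) := by gcongr; linarith
  have h2 : (j : ℝ) / (a - b) ≤ (j + b) / a := by
    rw [div_le_div_iff₀ hab ha]; nlinarith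
  have h3 : ((j : ℝ) + b) / a = j / a + b / a := add_div _ _ _
  have h4 : ((j : ℝ) + b) / a ≤ 1 := by rw [div_le_one ha]; linarith
  have h5 : (0 : ℝ) ≤ j / a := by positivity
  rw [Nat.cast_sub hb.le, abs_le]
  exact ⟨⟨h5.trans hξ.1, hξ.2.trans h4⟩, by linarith [hξ.1], by linarith [hξ.2]⟩

/-- If all mixed partials `∂^γ f`, `γ ≤ β`, exist and are continuous, then
`sup_{x ∈ [0,1]^d} |∂^β B_α(f)(x) − ∂^β f(x)| → 0` as `min_j α_j → ∞`: for every `ε > 0`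
there is `N` such that for every `α` with all components `≥ N` the supremum is `< ε`. -/
theorem mixedPartial_multiBernstein_tendsto (d : ℕ) (hd : 1 ≤ d) (β : Fin d → ℕ)
    (f : (Fin d → ℝ) → ℝ) (hf : HasContMixedPartials d β f) :
    ∀ ε > (0 : ℝ), ∃ N : ℕ, ∀ α : Fin d → ℕ, (∀ j, N ≤ α j) →
      (⨆ x : Set.Icc (0 : Fin d → ℝ) 1,
          |mixedPartial d β (multiBernstein d α f) x - mixedPartial d β f x|) < ε := by
  intro ε hε
  set g := mixedPartial d β f with hg
  have hgc : Continuous g := (hf β le_rfl).1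
  have hK : IsCompact (Set.Icc (0 : Fin d → ℝ) 1) := isCompact_Icc
  obtain ⟨M, hM⟩ := hK.exists_bound_of_continuousOn hgc.continuousOn
  simp only [Real.norm_eq_abs] at hM
  obtain ⟨δ, hδ, hgδ⟩ := Metric.uniformContinuousOn_iff.1
    (hK.uniformContinuousOn_of_continuous hgc.continuousOn) (ε / 4) (by positivity)
  have hM0 : 0 ≤ M := (abs_nonneg _).trans (hM 0 ⟨le_rfl, zero_le_one⟩)
  set κ : (Fin d → ℕ) → ℝ := fun α => ∏ i, ((α i).descFactorial (β i) : ℝ) / (α i : ℝ) ^ β i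
    with hκ
  set e : (Fin d → ℕ) → ℝ := fun α =>
    ∑ i, (((β i : ℝ) / α i) ^ 2 + 1 / (α i - β i : ℕ)) with he
  have hev (i : Fin d) : Filter.Tendsto (fun α : Fin d → ℕ => α i) Filter.atTop Filter.atTop :=
    Filter.tendsto_atTop_atTop.2 fun b => ⟨fun _ => b, fun α hα => hα i⟩
  have hκ1 : Filter.Tendsto κ Filter.atTop (nhds 1) := by
    have := tendsto_finsetProd Finset.univ fun i _ =>
      (tendsto_descFactorial_div_pow (β i)).comp (hev i)
    rwa [Finset.prod_const_one] at this
  have he0 : Filter.Tendsto e Filter.atTop (nhds 0) := by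
    have h (i : Fin d) : Filter.Tendsto (fun n : ℕ => ((β i : ℝ) / n) ^ 2 + 1 / (n - β i : ℕ))
        Filter.atTop (nhds 0) := by
      simpa using ((tendsto_const_div_atTop_nhds_zero_nat (β i : ℝ)).pow 2).add
        ((tendsto_const_div_atTop_nhds_zero_nat (1 : ℝ)).comp (Filter.tendsto_sub_atTop_nat (β i)))
    have := tendsto_finsetSum Finset.univ fun i _ => (h i).comp (hev i)
    rwa [Finset.sum_const_zero] at this
  have hlim : Filter.Tendsto (fun α => |κ α| * (ε / 4 + 4 * M / δ ^ 2 * e α) + |κ α - 1| * M)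
      Filter.atTop (nhds (ε / 4)) := by
    have := (hκ1.abs.mul ((he0.const_mul (4 * M / δ ^ 2)).const_add (ε / 4))).add
      ((hκ1.sub_const 1).abs.mul_const M)
    simpa using this
  obtain ⟨a, ha⟩ := Filter.eventually_atTop.1
    ((hlim.eventually (gt_mem_nhds (show ε / 4 < ε / 2 by linarith))).and
      (Filter.eventually_ge_atTop (β + 1)))
  refine ⟨∑ i, a i, fun α hα => ?_⟩
  obtain ⟨hlt, hβα⟩ := ha α fun i =>
    (Finset.single_le_sum (fun _ _ => Nat.zero_le _) (Finset.mem_univ i)).trans (hα i)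
  have hβα' : ∀ i, β i < α i := fun i => hβα i
  obtain ⟨ξ, hξ, hrep⟩ := exists_mixedPartial_multiBernstein_eq hf (α := α)
    (fun i => (Nat.zero_le _).trans_lt (hβα' i)) fun i => (hβα' i).le
  refine (Real.iSup_le (fun x => ?_) (by positivity : 0 ≤ ε / 2)).trans_lt (by linarith)
  have hA := abs_sum_bernsteinWeight_sub_le (n := fun i => α i - β i)
    (r := fun i => (β i : ℝ) / α i) (ξ := ξ) (by positivity) hδ hM
    (fun y hy z hz h => (hgδ y hy z hz h).le) (fun i => Nat.sub_pos_of_lt (hβα' i))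
    (fun j hj => by
      have := fun i => mem_Icc_and_abs_sub_div_le (hβα' i)
        (Nat.lt_succ_iff.1 (Finset.mem_range.1 (Fintype.mem_piFinset.1 hj i))) (hξ j hj i)
      exact ⟨⟨fun i => (this i).1.1, fun i => (this i).1.2⟩, fun i => (this i).2⟩) x.2
  rw [hrep]
  set s := ∑ j ∈ Fintype.piFinset (fun i => Finset.range (α i - β i + 1)),
    bernsteinWeight (fun i => α i - β i) j x * g (ξ j) with hs
  calc |κ α * s - g x| = |κ α * (s - g x) + (κ α - 1) * g x| := by ring_nf
    _ ≤ |κ α| * |s - g x| + |κ α - 1| * |g x| := by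
        rw [← abs_mul, ← abs_mul]; exact abs_add_le _ _
    _ ≤ |κ α| * (ε / 4 + 4 * M / δ ^ 2 * e α) + |κ α - 1| * M := by
        gcongr
        exact hM x x.2
    _ ≤ ε / 2 := hlt.le
end
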